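/- Let x₁: [0, τ₁] → ℝ² be a smooth parametrized Jordan curve (a smooth closed curve that is injective on [0, τ₁)), and let D₂ ⊆ ℝ² be a regular domain whose boundary has finite length L₂. Then the vector-valued integral satisfies |∫₀^{τ₁} χ_{D₂}(x₁(t)) · x₁′(t) dt| ≤ L₂ / 2, where |·| is the Euclidean norm on ℝ² and χ_{D₂} is the characteristic function of D₂. -/

import Mathlib

open MeasureTheory Metric Set Filter
open scoped RealInnerProductSpace ENNReal Topology

noncomputable section

/-- A *regular domain* in `ℝ^d`: a closed set which is an embedded `d`-dimensional smooth
submanifold with boundary.  Equivalently, near each boundary point the set is the sublevel set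
`{u ≤ 0}` of a smooth local defining function `u` with nonvanishing gradient; the outward unit
normal along the boundary is then `∇u/‖∇u‖`.  We bundle the outward unit normal field. -/
structure RegularDomain (d : ℕ) where
  carrier : Set (EuclideanSpace ℝ (Fin d))
  normal : EuclideanSpace ℝ (Fin d) → EuclideanSpace ℝ (Fin d)
  isClosed : IsClosed carrier
  regular : ∀ p ∈ frontier carrier,
    ∃ U : Set (EuclideanSpace ℝ (Fin d)), IsOpen U ∧ p ∈ U ∧
      ∃ u : EuclideanSpace ℝ (Fin d) → ℝ,
        ContDiffOn ℝ (⊤ : ℕ∞) u U ∧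
        (∀ x ∈ U, gradient u x ≠ 0) ∧
        carrier ∩ U = {x ∈ U | u x ≤ 0} ∧
        ∀ x ∈ frontier carrier ∩ U, normal x = ‖gradient u x‖⁻¹ • gradient u x

/-- The divergence `∇ · f` of a vector field on `ℝ^d`, as the trace of its derivative. -/
def vdiv {d : ℕ} (f : EuclideanSpace ℝ (Fin d) → EuclideanSpace ℝ (Fin d))
    (x : EuclideanSpace ℝ (Fin d)) : ℝ :=
  LinearMap.trace ℝ _ ((fderiv ℝ f x :
    EuclideanSpace ℝ (Fin d) →ₗ[ℝ] EuclideanSpace ℝ (Fin d)))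



lemma jc_log_branch (x x' : ℝ → ℂ) {a b : ℝ} (hab : a ≤ b) (Ω : Set ℝ) (hΩ : IsOpen Ω)
    (hsub : Icc a b ⊆ Ω) (hx : ∀ t ∈ Ω, HasDerivAt x (x' t) t) (hx' : ContinuousOn x' Ω) :
    ∃ Λ : ℂ → ℂ, ContinuousOn Λ (x '' Icc a b)ᶜ ∧
      ∀ z ∉ x '' Icc a b, Complex.exp (Λ z) = (z - x a) / (z - x b) := by
  have hxc : ContinuousOn x Ω := fun t ht => (hx t ht).continuousAt.continuousWithinAt
  refine ⟨fun z => ∫ t in a..b, x' t / (z - x t), ?_, ?_⟩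
  · have hcl : IsClosed (x '' Icc a b) :=
      (isCompact_Icc.image_of_continuousOn (hxc.mono hsub)).isClosed
    intro z0 hz0
    apply ContinuousAt.continuousWithinAt
    obtain ⟨d, hd, hball⟩ := Metric.isOpen_iff.1 hcl.isOpen_compl z0 hz0
    obtain ⟨M, hM⟩ := isCompact_Icc.exists_bound_of_continuousOn (hx'.mono hsub)
    have huI : uIoc a b ⊆ Icc a b := by
      rw [uIoc_of_le hab]; exact Ioc_subset_Icc_self
    have hfar : ∀ z ∈ ball z0 (d/2), ∀ t ∈ Icc a b, d/2 ≤ ‖z - x t‖ := by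
      intro z hz t ht
      have h1 : ¬ dist (x t) z0 < d := fun h => hball h ⟨t, ht, rfl⟩
      have h2 : dist z z0 < d/2 := hz
      have h3 := dist_triangle (x t) z z0
      rw [← dist_eq_norm, dist_comm z]
      linarith
    apply intervalIntegral.continuousAt_of_dominated_interval (bound := fun _ => M / (d/2))
    · filter_upwards [ball_mem_nhds z0 (half_pos hd)] with z hz
      have : ContinuousOn (fun t => x' t / (z - x t)) (uIoc a b) := by
        apply ContinuousOn.div (hx'.mono (huI.trans hsub))
          (continuousOn_const.sub (hxc.mono (huI.trans hsub)))
        intro t ht h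
        have := hfar z hz t (huI ht)
        rw [show z - x t = 0 from h] at this; simp at this; linarith
      exact this.aestronglyMeasurable measurableSet_uIoc
    · filter_upwards [ball_mem_nhds z0 (half_pos hd)] with z hz
      refine Eventually.of_forall fun t ht => ?_
      rw [norm_div]
      have h1 := hfar z hz t (huI ht)
      have h2 := hM t (huI ht)
      have : 0 ≤ M := (norm_nonneg _).trans h2
      gcongr
    · exact intervalIntegrable_const
    · refine Eventually.of_forall fun t ht => ?_
      apply ContinuousAt.div continuousAt_const (continuousAt_id.sub continuousAt_const)
      intro h
      have := hfar z0 (mem_ball_self (half_pos hd)) t (huI ht)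
      rw [show z0 - x t = 0 from h] at this; simp at this; linarith
  · intro z hz
    have hne : ∀ t ∈ Icc a b, z - x t ≠ 0 := fun t ht h => hz ⟨t, ht, (sub_eq_zero.1 h).symm⟩
    set Ω' := Ω ∩ x ⁻¹' {z}ᶜ with hΩ'
    have hop : IsOpen Ω' := hxc.isOpen_inter_preimage hΩ isOpen_compl_singleton
    have hsub' : Icc a b ⊆ Ω' := fun t ht => ⟨hsub ht, fun h => hz ⟨t, ht, h⟩⟩
    have hcont : ContinuousOn (fun t => x' t / (z - x t)) Ω' := by
      apply ContinuousOn.div (hx'.mono inter_subset_left)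
        (continuousOn_const.sub (hxc.mono inter_subset_left))
      intro t ht h
      exact ht.2 (sub_eq_zero.1 h).symm
    have hder : ∀ t ∈ Icc a b, HasDerivAt (fun u => ∫ t in a..u, x' t / (z - x t))
        (x' t / (z - x t)) t := by
      intro t ht
      apply intervalIntegral.integral_hasDerivAt_right
      · apply (hcont.mono _).intervalIntegrable
        rw [uIcc_of_le ht.1]
        exact (Icc_subset_Icc_right ht.2).trans hsub'
      · exact hcont.stronglyMeasurableAtFilter hop t (hsub' ht)
      · exact hcont.continuousAt (hop.mem_nhds (hsub' ht))
    have hder2 : ∀ t ∈ Icc a b, HasDerivAt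
        (fun u => Complex.exp (∫ t in a..u, x' t / (z - x t)) * (z - x u)) 0 t := by
      intro t ht
      have h1 := ((hder t ht).cexp).mul ((hx t (hsub ht)).const_sub z)
      refine h1.congr_deriv ?_
      rw [mul_assoc, div_mul_cancel₀ _ (hne t ht)]
      ring
    have := constant_of_has_deriv_right_zero
      (fun t ht => (hder2 t ht).continuousAt.continuousWithinAt)
      (fun t ht => (hder2 t (Ico_subset_Icc_self ht)).hasDerivWithinAt) b (right_mem_Icc.2 hab)
    simp only [intervalIntegral.integral_same, Complex.exp_zero, one_mul] at this
    rw [eq_div_iff (hne b (right_mem_Icc.2 hab))]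
    exact this

lemma jc_const (K : Set ℂ) (hK : IsPreconnected K) (φ : ℂ → ℂ) (hφ : ContinuousOn φ K)
    (h1 : ∀ z ∈ K, Complex.exp (φ z) = 1) {z w : ℂ} (hz : z ∈ K) (hw : w ∈ K) : φ z = φ w := by
  have hc : (range fun n : ℤ => (n : ℂ) * (2 * Real.pi * Complex.I)).Countable :=
    countable_range _
  have := hc.isTotallyDisconnected (φ '' K) ?_ (hK.image φ hφ)
  · exact this ⟨z, hz, rfl⟩ ⟨w, hw, rfl⟩
  · rintro _ ⟨z, hz, rfl⟩
    obtain ⟨n, hn⟩ := Complex.exp_eq_one_iff.1 (h1 z hz)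
    exact ⟨n, hn.symm⟩

/-- If the real part is strictly off `s` on both sides, no connected set avoiding the arc and the
segment may join the two sides of the segment. -/
lemma jc_jump (x x' : ℝ → ℂ) {a b : ℝ} (hab : a ≤ b) (Ω : Set ℝ) (hΩ : IsOpen Ω)
    (hsub : Icc a b ⊆ Ω) (hx : ∀ t ∈ Ω, HasDerivAt x (x' t) t) (hx' : ContinuousOn x' Ω)
    (him : x a ≠ x b)
    (K : Set ℂ) (hK : IsPreconnected K) (hKE : Disjoint K (x '' Icc a b))
    (hKS : Disjoint K (segment ℝ (x a) (x b)))
    (c : ℂ) (hc : c = (x a + x b) / 2) (hcE : c ∉ x '' Icc a b)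
    (hKR : ∀ᶠ η : ℝ in 𝓝[>] 0, c + η ∈ K) (hKL : ∀ᶠ η : ℝ in 𝓝[>] 0, c - η ∈ K) : False := by
  obtain ⟨Λ, hΛc, hΛ⟩ := jc_log_branch x x' hab Ω hΩ hsub hx hx'
  have hxc : ContinuousOn x (Icc a b) :=
    fun t ht => (hx t (hsub ht)).continuousAt.continuousWithinAt
  have hcl : IsClosed (x '' Icc a b) := (isCompact_Icc.image_of_continuousOn hxc).isClosed
  have haE : x a ∈ x '' Icc a b := ⟨a, left_mem_Icc.2 hab, rfl⟩
  have hbE : x b ∈ x '' Icc a b := ⟨b, right_mem_Icc.2 hab, rfl⟩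
  set m : ℂ → ℂ := fun z => (z - x a) / (z - x b) with hm
  have hKnot : ∀ z ∈ K, z ∉ x '' Icc a b := fun z hz h => disjoint_left.1 hKE hz h
  have hKa : ∀ z ∈ K, z - x a ≠ 0 := fun z hz h => hKnot z hz (by rwa [sub_eq_zero.1 h])
  have hKb : ∀ z ∈ K, z - x b ≠ 0 := fun z hz h => hKnot z hz (by rwa [sub_eq_zero.1 h])
  have hslit : ∀ z ∈ K, m z ∈ Complex.slitPlane := by
    intro z hz
    by_contra hns
    rw [Complex.mem_slitPlane_iff_not_le_zero, not_not] at hns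
    rw [Complex.le_def] at hns
    obtain ⟨h1, h2⟩ := hns
    simp only [Complex.zero_re, Complex.zero_im] at h1 h2
    set r := -(m z).re with hr
    have hmz : m z = -(r : ℂ) := by
      apply Complex.ext <;> simp [hr, h2]
    have hr0 : 0 ≤ r := by linarith
    have h3 : z - x a = -(r : ℂ) * (z - x b) := by
      rw [← hmz]; simp only [hm]; rw [div_mul_cancel₀ _ (hKb z hz)]
    apply disjoint_left.1 hKS hz
    refine ⟨1 / (1 + r), r / (1 + r), by positivity, by positivity, by field_simp, ?_⟩
    have h4 : (1 + (r:ℂ)) ≠ 0 := by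
      have : (1 + r) ≠ 0 := by positivity
      exact_mod_cast this
    simp only [Complex.real_smul]
    push_cast
    field_simp
    linear_combination -h3
  have hmc : ContinuousOn m K :=
    (continuousOn_id.sub continuousOn_const).div (continuousOn_id.sub continuousOn_const) hKb
  set φ : ℂ → ℂ := fun z => Λ z - Complex.log (m z) with hφ
  have hφc : ContinuousOn φ K := by
    refine (hΛc.mono hKnot).sub ?_
    exact hmc.clog hslit
  have hφ1 : ∀ z ∈ K, Complex.exp (φ z) = 1 := by
    intro z hz
    simp only [hφ]
    rw [Complex.exp_sub, hΛ z (hKnot z hz), Complex.exp_log, div_self]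
    · exact div_ne_zero (hKa z hz) (hKb z hz)
    · exact div_ne_zero (hKa z hz) (hKb z hz)
  have hinv : ∀ η : ℝ, m (c - η) = (m (c + η))⁻¹ := by
    intro η
    simp only [hm, hc, inv_div]
    rw [← neg_div_neg_eq]
    congr 1 <;> ring
  have key : ∀ᶠ η : ℝ in 𝓝[>] 0, Complex.exp ((Λ (c + η) - Λ (c - η)) / 2) = m (c + η) := by
    filter_upwards [hKR, hKL] with η h1 h2
    have h3 := jc_const K hK φ hφc hφ1 h1 h2
    simp only [hφ] at h3
    rw [hinv, Complex.log_inv _ (Complex.slitPlane_arg_ne_pi (hslit _ h1))] at h3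
    have : (Λ (c + η) - Λ (c - η)) / 2 = Complex.log (m (c + η)) := by
      linear_combination h3 / 2
    rw [this, Complex.exp_log (div_ne_zero (hKa _ h1) (hKb _ h1))]
  have hΛat : ContinuousAt Λ c := hΛc.continuousAt (hcl.isOpen_compl.mem_nhds hcE)
  have hp : Tendsto (fun η : ℝ => c + (η : ℂ)) (𝓝[>] 0) (𝓝 c) := by
    have : Continuous (fun η : ℝ => c + (η : ℂ)) := by fun_prop
    have h := (this.tendsto 0).mono_left (nhdsWithin_le_nhds (s := Ioi 0))
    simpa using h
  have hn : Tendsto (fun η : ℝ => c - (η : ℂ)) (𝓝[>] 0) (𝓝 c) := by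
    have : Continuous (fun η : ℝ => c - (η : ℂ)) := by fun_prop
    have h := (this.tendsto 0).mono_left (nhdsWithin_le_nhds (s := Ioi 0))
    simpa using h
  have hl : Tendsto (fun η : ℝ => Complex.exp ((Λ (c + η) - Λ (c - η)) / 2)) (𝓝[>] 0) (𝓝 1) := by
    have h := (((hΛat.tendsto.comp hp).sub (hΛat.tendsto.comp hn)).div_const 2).cexp
    simpa using h
  have hcb : c - x b ≠ 0 := by
    rw [hc]; intro h; apply him; linear_combination 2 * h
  have hmat : ContinuousAt m c :=
    (continuousAt_id.sub continuousAt_const).div (continuousAt_id.sub continuousAt_const) hcb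
  have hr := hmat.tendsto.comp hp
  have h1 := tendsto_nhds_unique (hl.congr' key) hr
  have h2 : m c = -1 := by
    simp only [hm]
    rw [div_eq_iff hcb, hc]; ring
  rw [h2] at h1
  norm_num at h1

/-- A half-strip near the segment from `c` to `x b`, on the right, avoids the arc. -/
lemma jc_strip (E₁ : Set ℂ) (hE₁ : IsClosed E₁) (T : Set ℂ) (hT : IsCompact T)
    (hTc : Convex ℝ T) (hd : Disjoint T E₁) (H : Set ℂ) (hH : Convex ℝ H) :
    ∃ ρ > 0, IsPreconnected (thickening ρ T ∩ H) ∧ Disjoint (thickening ρ T ∩ H) E₁ := by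
  obtain ⟨ρ, hρ, h⟩ := hd.exists_thickenings hT hE₁
  refine ⟨ρ, hρ, ((hTc.thickening ρ).inter hH).isPreconnected, ?_⟩
  exact h.mono inter_subset_left (self_subset_thickening hρ _)

/-- Two consecutive crossings of a vertical line by a simple closed curve cannot both go from
left to right. -/
lemma jc_core (γ γ' : ℝ → ℂ) (τ : ℝ) (hd : ∀ t ∈ Ioo 0 τ, HasDerivAt γ (γ' t) t)
    (hc' : ContinuousOn γ' (Ioo 0 τ)) (hc : ContinuousOn γ (Icc 0 τ)) (hcl : γ τ = γ 0)
    (hinj : InjOn γ (Ico 0 τ)) (a b : ℝ) (ha : 0 < a) (hab : a < b) (hb : b < τ) (s : ℝ)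
    (hsa : (γ a).re = s) (hsb : (γ b).re = s) (hpa : 0 < (γ' a).re) (hpb : 0 < (γ' b).re)
    (hadj : ∀ t ∈ Icc 0 τ, γ t ∉ openSegment ℝ (γ a) (γ b)) : False := by
  have haI : a ∈ Ioo 0 τ := ⟨ha, hab.trans hb⟩
  have hbI : b ∈ Ioo 0 τ := ⟨ha.trans hab, hb⟩
  have hsign : ∀ r ∈ Ioo 0 τ, (γ r).re = s → 0 < (γ' r).re →
      ∀ᶠ t in 𝓝 r, SignType.sign ((γ t).re - s) = SignType.sign (t - r) := by
    intro r hr hs hp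
    have h1 : HasDerivAt (fun t => (γ t).re - s) (γ' r).re r := by
      have := (Complex.reCLM.hasFDerivAt.comp_hasDerivAt r (hd r hr)).sub_const s
      exact this
    have := eventually_nhdsWithin_sign_eq_of_deriv_pos (f := fun t => (γ t).re - s) (x₀ := r)
      (by rw [h1.deriv]; exact hp) (by simp [hs])
    exact this
  have hne : γ a ≠ γ b := fun h =>
    hab.ne (hinj ⟨ha.le, haI.2⟩ ⟨hbI.1.le, hb⟩ h)
  set c : ℂ := (γ a + γ b) / 2 with hcdef
  have hcre : c.re = s := by
    have : (2 : ℂ) * c = γ a + γ b := by rw [hcdef]; ring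
    have h2 := congrArg Complex.re this
    simp [hsa, hsb] at h2
    linarith
  have hcO : c ∈ openSegment ℝ (γ a) (γ b) := by
    refine ⟨1/2, 1/2, by norm_num, by norm_num, by norm_num, ?_⟩
    simp only [Complex.real_smul, hcdef]; push_cast; ring
  -- membership facts for the two half segments
  have hseg_sub : ∀ e : ℂ, (e = γ a ∨ e = γ b) → ∀ z ∈ segment ℝ c e, z = e ∨
      z ∈ openSegment ℝ (γ a) (γ b) := by
    intro e he z hz
    by_cases hze : z = e
    · exact Or.inl hze
    right
    have hes : e ∈ segment ℝ (γ a) (γ b) := by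
      rcases he with rfl | rfl
      · exact left_mem_segment _ _ _
      · exact right_mem_segment _ _ _
    obtain ⟨p, q, hp, hq, hpq, rfl⟩ := hz
    have hp0 : 0 < p := by
      rcases hp.lt_or_eq with h | h
      · exact h
      · exfalso; apply hze
        have : q = 1 := by linarith
        simp [← h, this]
    rcases he with he | he
    · refine ⟨p/2 + q, p/2, by positivity, by positivity, by linarith, ?_⟩
      simp only [Complex.real_smul, hcdef, he]; push_cast; ring
    · refine ⟨p/2, p/2 + q, by positivity, by positivity, by linarith, ?_⟩
      simp only [Complex.real_smul, hcdef, he]; push_cast; ring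
  have hSre : ∀ z ∈ segment ℝ (γ a) (γ b), z.re = s := by
    rintro _ ⟨p, q, hp, hq, hpq, rfl⟩
    simp only [Complex.add_re, Complex.real_smul, Complex.re_ofReal_mul, hsa, hsb]
    rw [← add_mul, hpq, one_mul]
  have hsubI : Icc a b ⊆ Ioo 0 τ := fun t ht => ⟨ha.trans_le ht.1, ht.2.trans_lt hb⟩
  have hsubI' : Ioo 0 τ ⊆ Ico 0 τ := Ioo_subset_Ico_self
  have hIccI : Icc a b ⊆ Icc 0 τ := hsubI.trans Ioo_subset_Icc_self
  -- neighbourhoods in time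
  obtain ⟨ν, hν, hνa, hνb⟩ : ∃ ν > 0,
      (∀ t, |t - a| < ν → SignType.sign ((γ t).re - s) = SignType.sign (t - a)) ∧
      (∀ t, |t - b| < ν → SignType.sign ((γ t).re - s) = SignType.sign (t - b)) := by
    obtain ⟨e1, h1, H1⟩ := Metric.eventually_nhds_iff.1 (hsign a haI hsa hpa)
    obtain ⟨e2, h2, H2⟩ := Metric.eventually_nhds_iff.1 (hsign b hbI hsb hpb)
    refine ⟨min e1 e2, lt_min h1 h2, fun t ht => H1 ?_, fun t ht => H2 ?_⟩
    · rw [Real.dist_eq]; exact ht.trans_le (min_le_left _ _)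
    · rw [Real.dist_eq]; exact ht.trans_le (min_le_right _ _)
  -- right strip
  obtain ⟨ρR, hρR, hRpre, hRdis⟩ := jc_strip (γ '' Icc a (b - ν))
    ((isCompact_Icc.image_of_continuousOn (hc.mono (fun t ht => hIccI ⟨ht.1, by linarith [ht.2]⟩))).isClosed)
    (segment ℝ c (γ b)) (by rw [segment_eq_image_lineMap]; exact isCompact_Icc.image (AffineMap.lineMap_continuous))
    (convex_segment _ _) (by
      rw [disjoint_left]
      rintro z hz ⟨t, ht, rfl⟩
      have htI : t ∈ Icc a b := ⟨ht.1, by linarith [ht.2]⟩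
      rcases hseg_sub _ (Or.inr rfl) _ hz with h | h
      · have := hinj (hsubI' (hsubI htI)) (hsubI' hbI) h
        linarith [ht.2]
      · exact hadj t (hIccI htI) h)
    {z : ℂ | s < z.re} (convex_halfSpace_re_gt s)
  obtain ⟨ρL, hρL, hLpre, hLdis⟩ := jc_strip (γ '' Icc (a + ν) b)
    ((isCompact_Icc.image_of_continuousOn (hc.mono (fun t ht => hIccI ⟨by linarith [ht.1], ht.2⟩))).isClosed)
    (segment ℝ c (γ a)) (by rw [segment_eq_image_lineMap]; exact isCompact_Icc.image (AffineMap.lineMap_continuous))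
    (convex_segment _ _) (by
      rw [disjoint_left]
      rintro z hz ⟨t, ht, rfl⟩
      have htI : t ∈ Icc a b := ⟨by linarith [ht.1], ht.2⟩
      rcases hseg_sub _ (Or.inl rfl) _ hz with h | h
      · have := hinj (hsubI' (hsubI htI)) (hsubI' haI) h
        linarith [ht.1]
      · exact hadj t (hIccI htI) h)
    {z : ℂ | z.re < s} (convex_halfSpace_re_lt s)
  set R := thickening ρR (segment ℝ c (γ b)) ∩ {z : ℂ | s < z.re} with hR
  set L := thickening ρL (segment ℝ c (γ a)) ∩ {z : ℂ | z.re < s} with hL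
  have hRE : Disjoint R (γ '' Icc a b) := by
    rw [disjoint_left]
    rintro z hz ⟨t, ht, rfl⟩
    by_cases h : t ≤ b - ν
    · exact disjoint_left.1 hRdis hz ⟨t, ⟨ht.1, h⟩, rfl⟩
    · have h2 : |t - b| < ν := by rw [abs_lt]; constructor <;> linarith [ht.2]
      have h3 := hνb t h2
      have h4 : s < (γ t).re := hz.2
      rw [sign_pos (by linarith)] at h3
      have := sign_eq_one_iff.1 h3.symm
      linarith [ht.2]
  have hLE : Disjoint L (γ '' Icc a b) := by
    rw [disjoint_left]
    rintro z hz ⟨t, ht, rfl⟩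
    by_cases h : a + ν ≤ t
    · exact disjoint_left.1 hLdis hz ⟨t, ⟨h, ht.2⟩, rfl⟩
    · have h2 : |t - a| < ν := by rw [abs_lt]; constructor <;> linarith [ht.1]
      have h3 := hνa t h2
      have h4 : (γ t).re < s := hz.2
      rw [sign_neg (by linarith)] at h3
      have := sign_eq_neg_one_iff.1 h3.symm
      linarith [ht.1]
  -- entry points
  obtain ⟨b', hb'1, hb'2, hb'R⟩ : ∃ b', b < b' ∧ b' < τ ∧ γ b' ∈ R := by
    have h1 : ∀ᶠ t in 𝓝[>] b, γ t ∈ thickening ρR (segment ℝ c (γ b)) := by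
      apply ((hd b hbI).continuousAt.mono_left nhdsWithin_le_nhds)
      exact isOpen_thickening.mem_nhds (self_subset_thickening hρR _ (right_mem_segment _ _ _))
    have h2 : ∀ᶠ t in 𝓝[>] b, t ∈ Ioo b (min τ (b + ν)) :=
      Ioo_mem_nhdsGT (lt_min hb (by linarith))
    obtain ⟨t, ht1, ht2⟩ := (h1.and h2).exists
    have h5 : t < τ := ht2.2.trans_le (min_le_left _ _)
    have h6 : t < b + ν := ht2.2.trans_le (min_le_right _ _)
    have h3 := hνb t (by rw [abs_lt]; constructor <;> linarith [ht2.1])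
    rw [sign_pos (a := t - b) (by linarith [ht2.1])] at h3
    have := sign_eq_one_iff.1 h3
    exact ⟨t, ht2.1, h5, ht1, by simp only [mem_ofPred_eq]; linarith⟩
  obtain ⟨a', ha'1, ha'2, ha'L⟩ : ∃ a', a' < a ∧ 0 < a' ∧ γ a' ∈ L := by
    have h1 : ∀ᶠ t in 𝓝[<] a, γ t ∈ thickening ρL (segment ℝ c (γ a)) := by
      apply ((hd a haI).continuousAt.mono_left nhdsWithin_le_nhds)
      exact isOpen_thickening.mem_nhds (self_subset_thickening hρL _ (right_mem_segment _ _ _))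
    have h2 : ∀ᶠ t in 𝓝[<] a, t ∈ Ioo (max 0 (a - ν)) a :=
      Ioo_mem_nhdsLT (max_lt ha (by linarith))
    obtain ⟨t, ht1, ht2⟩ := (h1.and h2).exists
    have h5 : 0 < t := (le_max_left _ _).trans_lt ht2.1
    have h6 : a - ν < t := (le_max_right _ _).trans_lt ht2.1
    have h3 := hνa t (by rw [abs_lt]; constructor <;> linarith [ht2.2])
    rw [sign_neg (a := t - a) (by linarith [ht2.2])] at h3
    have := sign_eq_neg_one_iff.1 h3
    exact ⟨t, ht2.2, h5, ht1, by simp only [mem_ofPred_eq]; linarith⟩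
  set A₁ := γ '' Icc b' τ with hA₁
  set A₂ := γ '' Icc 0 a' with hA₂
  have hA₁p : IsPreconnected A₁ := isPreconnected_Icc.image _
    (hc.mono (Icc_subset_Icc_left (by linarith [hbI.1])))
  have hA₂p : IsPreconnected A₂ := isPreconnected_Icc.image _
    (hc.mono (Icc_subset_Icc_right (by linarith)))
  have hK1 : IsPreconnected (R ∪ A₁) :=
    hRpre.union (γ b') hb'R ⟨b', ⟨le_rfl, hb'2.le⟩, rfl⟩ hA₁p
  have hK2 : IsPreconnected (A₂ ∪ L) :=
    hA₂p.union (γ a') ⟨a', ⟨ha'2.le, le_rfl⟩, rfl⟩ ha'L hLpre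
  have hK : IsPreconnected ((R ∪ A₁) ∪ (A₂ ∪ L)) :=
    hK1.union (γ 0) (Or.inr ⟨τ, ⟨hb'2.le, le_rfl⟩, hcl⟩) (Or.inl ⟨0, ⟨le_rfl, ha'2.le⟩, rfl⟩) hK2
  -- points of the complementary arc
  have hA : ∀ z ∈ A₁ ∪ A₂, ∃ t ∈ Ico 0 τ, (t < a ∨ b < t) ∧ γ t = z := by
    rintro z (⟨t, ht, rfl⟩ | ⟨t, ht, rfl⟩)
    · by_cases h : t = τ
      · exact ⟨0, ⟨le_rfl, by linarith [ha]⟩, Or.inl ha, by rw [h, hcl]⟩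
      · exact ⟨t, ⟨by linarith [ht.1, hbI.1], lt_of_le_of_ne ht.2 h⟩, Or.inr (by linarith [ht.1]), rfl⟩
    · exact ⟨t, ⟨ht.1, by linarith [ht.2, haI.2]⟩, Or.inl (by linarith [ht.2]), rfl⟩
  have hAE : Disjoint (A₁ ∪ A₂) (γ '' Icc a b) := by
    rw [disjoint_left]
    rintro z hz ⟨r, hr, rfl⟩
    obtain ⟨t, ht, ht', h⟩ := hA _ hz
    have := hinj ht (hsubI' (hsubI hr)) h
    rcases ht' with h' | h' <;> linarith [hr.1, hr.2]
  have hAS : Disjoint (A₁ ∪ A₂) (segment ℝ (γ a) (γ b)) := by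
    rw [disjoint_left]
    intro z hz hzS
    obtain ⟨t, ht, ht', h⟩ := hA _ hz
    rw [← insert_endpoints_openSegment] at hzS
    rcases hzS with h1 | h1 | h1
    · exact disjoint_left.1 hAE hz ⟨a, ⟨le_rfl, hab.le⟩, h1.symm⟩
    · exact disjoint_left.1 hAE hz ⟨b, ⟨hab.le, le_rfl⟩, h1.symm⟩
    · exact hadj t (Ico_subset_Icc_self ht) (h ▸ h1)
  have hRS : Disjoint R (segment ℝ (γ a) (γ b)) := by
    rw [disjoint_left]
    intro z hz hzS
    have h1 : s < z.re := hz.2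
    linarith [hSre z hzS]
  have hLS : Disjoint L (segment ℝ (γ a) (γ b)) := by
    rw [disjoint_left]
    intro z hz hzS
    have h1 : z.re < s := hz.2
    linarith [hSre z hzS]
  rw [disjoint_union_left] at hAE hAS
  refine jc_jump γ γ' hab.le (Ioo 0 τ) isOpen_Ioo hsubI hd hc' hne ((R ∪ A₁) ∪ (A₂ ∪ L)) hK
    ?_ ?_ c hcdef ?_ ?_ ?_
  · simp only [disjoint_union_left]
    exact ⟨⟨hRE, hAE.1⟩, hAE.2, hLE⟩
  · simp only [disjoint_union_left]
    exact ⟨⟨hRS, hAS.1⟩, hAS.2, hLS⟩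
  · rintro ⟨t, ht, h⟩
    exact hadj t (hIccI ht) (h ▸ hcO)
  · filter_upwards [Ioo_mem_nhdsGT hρR] with η hη
    refine Or.inl (Or.inl ⟨?_, ?_⟩)
    · rw [mem_thickening_iff]
      refine ⟨c, left_mem_segment _ _ _, ?_⟩
      simp [abs_of_pos hη.1, hη.2]
    · simp [hcre, hη.1]
  · filter_upwards [Ioo_mem_nhdsGT hρL] with η hη
    refine Or.inr (Or.inr ⟨?_, ?_⟩)
    · rw [mem_thickening_iff]
      refine ⟨c, left_mem_segment _ _ _, ?_⟩
      simp [dist_eq_norm, abs_of_pos hη.1, hη.2]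
    · simp [hcre, hη.1]

/-- `y` is a right end point of `B`. -/
def JcREnd (B : Set ℝ) (y : ℝ) : Prop := (∀ᶠ w in 𝓝[<] y, w ∈ B) ∧ (∀ᶠ w in 𝓝[>] y, w ∉ B)

/-- `y` is a left end point of `B`. -/
def JcLEnd (B : Set ℝ) (y : ℝ) : Prop := (∀ᶠ w in 𝓝[<] y, w ∉ B) ∧ (∀ᶠ w in 𝓝[>] y, w ∈ B)

open Classical in
lemma jc_comb_right (B : Set ℝ) (Hm : Finset ℝ) (hr : ∀ y ∈ B, ∃ z, z ∉ B ∧ y < z)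
    (hsep : ∀ y ∈ B, ∀ z, z ∉ B → y < z → ∃ h ∈ Hm, y ≤ h ∧ h ≤ z) (P Q : Finset ℝ)
    (hPQ : ∀ y ∈ P, ∀ y' ∈ P, y < y' → ∃ z ∈ Q, y < z ∧ z < y') :
    (P.filter (· ∈ B)).card ≤ (Q.filter (· ∈ B)).card + Hm.card := by
  have hex : ∀ y ∈ B, ∃ h ∈ Hm, y ≤ h ∧ ∀ h' ∈ Hm, y ≤ h' → h ≤ h' := by
    intro y hy
    obtain ⟨z, hz, hyz⟩ := hr y hy
    obtain ⟨h, hh, h1, h2⟩ := hsep y hy z hz hyz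
    obtain ⟨m, hm, hmin⟩ := (Hm.filter (y ≤ ·)).exists_min_image id ⟨h, by simp [hh, h1]⟩
    simp only [Finset.mem_filter, id] at hm hmin
    exact ⟨m, hm.1, hm.2, fun h' a b => hmin h' ⟨a, b⟩⟩
  choose! r hr1 hr2 hr3 using hex
  rw [Finset.card_eq_sum_card_fiberwise (f := r) (t := Hm) (s := P.filter (· ∈ B))
      (fun y hy => hr1 y (by simpa using (Finset.mem_filter.1 hy).2)),
    Finset.card_eq_sum_card_fiberwise (f := r) (t := Hm) (s := Q.filter (· ∈ B))
      (fun y hy => hr1 y (by simpa using (Finset.mem_filter.1 hy).2)),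
    Finset.card_eq_sum_ones, ← Finset.sum_add_distrib]
  apply Finset.sum_le_sum
  intro h hh
  apply Finset.card_le_of_interleaved
  intro y hy y' hy' hlt _
  simp only [Finset.mem_filter] at hy hy' ⊢
  obtain ⟨⟨hyP, hyB⟩, hyr⟩ := hy
  obtain ⟨⟨hyP', hyB'⟩, hyr'⟩ := hy'
  obtain ⟨z, hzQ, h1, h2⟩ := hPQ y hyP y' hyP' hlt
  have hzB : z ∈ B := by
    by_contra hzB
    obtain ⟨k, hk, hk1, hk2⟩ := hsep y hyB z hzB h1
    have h3 := hr3 y hyB k hk hk1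
    have h4 := hr2 y' hyB'
    linarith
  refine ⟨z, ⟨⟨hzQ, hzB⟩, ?_⟩, h1, h2⟩
  apply le_antisymm
  · apply hr3 z hzB h hh
    have h4 := hr2 y' hyB'
    linarith
  · rw [← hyr]
    exact hr3 y hyB _ (hr1 z hzB) (h1.le.trans (hr2 z hzB))

lemma jc_sep_right (B : Set ℝ)
    (htri : ∀ y, B ∈ 𝓝 y ∨ Bᶜ ∈ 𝓝 y ∨ JcREnd B y ∨ JcLEnd B y)
    (y : ℝ) (hy : y ∈ B) (z : ℝ) (hz : z ∉ B) (hyz : y < z) :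
    ∃ h, JcREnd B h ∧ y ≤ h ∧ h ≤ z := by
  set W := B ∩ Icc y z with hW
  have hWne : W.Nonempty := ⟨y, hy, le_rfl, hyz.le⟩
  have hbd : BddAbove W := ⟨z, by rintro w hw; exact hw.2.2⟩
  set h := sSup W with hh
  have hlub : IsLUB W h := isLUB_csSup hWne hbd
  have hyh : y ≤ h := hlub.1 ⟨hy, le_rfl, hyz.le⟩
  have hhz : h ≤ z := hlub.2 (by rintro w hw; exact hw.2.2)
  refine ⟨h, ?_, hyh, hhz⟩
  have hright : ∀ w, h < w → w ≤ z → w ∉ B := fun w h1 h2 h3 =>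
    absurd (hlub.1 (show w ∈ W from ⟨h3, by linarith, h2⟩)) (not_le.2 h1)
  have hfreq : ∃ᶠ w in 𝓝[≤] h, w ∈ B := (hlub.frequently_mem hWne).mono fun w hw => hw.1
  rcases hhz.lt_or_eq with hlt | heq
  · have hev : ∀ᶠ w in 𝓝[>] h, w ∉ B := by
      filter_upwards [Ioo_mem_nhdsGT hlt] with w hw using hright w hw.1 hw.2.le
    rcases htri h with h1 | h1 | h1 | h1
    · have h2 : ∀ᶠ w in 𝓝[>] h, w ∈ B := nhdsWithin_le_nhds h1
      obtain ⟨w, hw1, hw2⟩ := (hev.and h2).exists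
      exact absurd hw2 hw1
    · have h2 : ∀ᶠ w in 𝓝[≤] h, w ∈ Bᶜ := nhdsWithin_le_nhds h1
      exact absurd h2 hfreq
    · exact h1
    · obtain ⟨w, hw1, hw2⟩ := (hev.and h1.2).exists
      exact absurd hw2 hw1
  · have hhB : h ∉ B := by rw [heq]; exact hz
    rcases htri h with h1 | h1 | h1 | h1
    · exact absurd (mem_of_mem_nhds h1) hhB
    · have h2 : ∀ᶠ w in 𝓝[≤] h, w ∈ Bᶜ := nhdsWithin_le_nhds h1
      exact absurd h2 hfreq
    · exact h1
    · exfalso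
      apply hfreq
      have := h1.1
      rw [← Iio_insert, nhdsWithin_insert]
      exact eventually_sup.2 ⟨by simpa using hhB, this⟩

lemma jc_neg_REnd (B : Set ℝ) (y : ℝ) : JcREnd (Neg.neg ⁻¹' B) y ↔ JcLEnd B (-y) := by
  unfold JcREnd JcLEnd
  have h1 : 𝓝[<] (-y) = map Neg.neg (𝓝[>] y) := by
    have := (Homeomorph.neg ℝ).isInducing
    rw [show 𝓝[<] (-y) = map Neg.neg (𝓝[>] y) from ?_]
    have h2 := (Homeomorph.neg ℝ).isOpenEmbedding.map_nhdsWithin_preimage_eq (Iio (-y)) y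
    simp only [Homeomorph.coe_neg] at h2
    rw [← h2]; congr 2; ext w; simp
  have h3 : 𝓝[>] (-y) = map Neg.neg (𝓝[<] y) := by
    have h2 := (Homeomorph.neg ℝ).isOpenEmbedding.map_nhdsWithin_preimage_eq (Ioi (-y)) y
    simp only [Homeomorph.coe_neg] at h2
    rw [← h2]; congr 2; ext w; simp
  rw [h1, h3]
  simp only [eventually_map, mem_preimage]
  tauto

lemma jc_neg_LEnd (B : Set ℝ) (y : ℝ) : JcLEnd (Neg.neg ⁻¹' B) y ↔ JcREnd B (-y) := by
  have := jc_neg_REnd (Neg.neg ⁻¹' B) (-y)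
  rw [neg_neg, ← preimage_comp, neg_comp_neg, preimage_id] at this
  exact this.symm

open Classical in
lemma jc_comb (B : Set ℝ)
    (htri : ∀ y, B ∈ 𝓝 y ∨ Bᶜ ∈ 𝓝 y ∨ JcREnd B y ∨ JcLEnd B y)
    (hup : ∀ y, ∃ z, z ∉ B ∧ y < z) (hdown : ∀ y, ∃ z, z ∉ B ∧ z < y)
    (P Q : Finset ℝ)
    (hPQ : ∀ y ∈ P, ∀ y' ∈ P, y < y' → ∃ z ∈ Q, y < z ∧ z < y')
    (H : Finset ℝ) (hH : ∀ y, JcREnd B y ∨ JcLEnd B y → y ∈ H) :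
    2 * (P.filter (· ∈ B)).card ≤ 2 * (Q.filter (· ∈ B)).card + H.card := by
  have h1 := jc_comb_right B (H.filter (JcREnd B)) (fun y _ => hup y)
    (fun y hy z hz hyz => by
      obtain ⟨h, h1, h2, h3⟩ := jc_sep_right B htri y hy z hz hyz
      exact ⟨h, by simp [h1, hH h (Or.inl h1)], h2, h3⟩) P Q hPQ
  have hinj : Function.Injective (Neg.neg : ℝ → ℝ) := neg_injective
  have h2 := jc_comb_right (Neg.neg ⁻¹' B) ((H.filter (JcLEnd B)).image Neg.neg)
    (fun y _ => by
      obtain ⟨z, hz, hz'⟩ := hdown (-y)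
      exact ⟨-z, by simpa using hz, by linarith⟩)
    (fun y hy z hz hyz => by
      obtain ⟨h, h1, h2, h3⟩ := jc_sep_right (Neg.neg ⁻¹' B) (fun y => by
        rw [jc_neg_REnd, jc_neg_LEnd]
        have hc : Tendsto (Neg.neg : ℝ → ℝ) (𝓝 y) (𝓝 (-y)) := continuous_neg.tendsto y
        rcases htri (-y) with h | h | h | h
        · exact Or.inl (hc h)
        · exact Or.inr (Or.inl (hc h))
        · tauto
        · tauto) y hy z hz hyz
      rw [jc_neg_REnd] at h1
      refine ⟨h, ?_, h2, h3⟩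
      rw [Finset.mem_image]
      exact ⟨-h, by simp [h1, hH _ (Or.inr h1)], by simp⟩)
    (P.image Neg.neg) (Q.image Neg.neg) (by
      intro y hy y' hy' hlt
      simp only [Finset.mem_image] at hy hy' ⊢
      obtain ⟨p, hp, rfl⟩ := hy
      obtain ⟨p', hp', rfl⟩ := hy'
      obtain ⟨z, hz, h1, h2⟩ := hPQ p' hp' p hp (by linarith)
      exact ⟨-z, ⟨z, hz, rfl⟩, by linarith, by linarith⟩)
  have him : ∀ S : Finset ℝ, ((S.image Neg.neg).filter (· ∈ (Neg.neg ⁻¹' B : Set ℝ))).card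
      = (S.filter (· ∈ B)).card := by
    intro S
    rw [Finset.filter_image, Finset.card_image_of_injective _ hinj]
    simp
  rw [him, him, Finset.card_image_of_injective _ hinj] at h2
  have h3 : (H.filter (JcREnd B)).card + (H.filter (JcLEnd B)).card ≤ H.card := by
    rw [← Finset.card_union_of_disjoint]
    · apply Finset.card_le_card
      intro y hy
      simp only [Finset.mem_union, Finset.mem_filter] at hy
      tauto
    · rw [Finset.disjoint_left]
      intro y hy hy'
      simp only [Finset.mem_filter] at hy hy'
      obtain ⟨w, hw1, hw2⟩ := (hy.2.1.and hy'.2.1).exists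
      exact hw2 hw1
  omega

lemma jc_locally_inj (f f' : ℝ → ℝ) (O : Set ℝ) (hO : IsOpen O)
    (hd : ∀ t ∈ O, HasDerivAt f (f' t) t) (hne : ∀ t ∈ O, f' t ≠ 0) (hc : ContinuousOn f' O) :
    ∀ t ∈ O, ∃ V : Set ℝ, IsOpen V ∧ t ∈ V ∧ InjOn f V := by
  intro t ht
  have h1 : HasStrictDerivAt f (f' t) t := by
    apply hasStrictDerivAt_of_hasDerivAt_of_continuousAt
    · filter_upwards [hO.mem_nhds ht] with u hu using hd u hu
    · exact hc.continuousAt (hO.mem_nhds ht)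
  have h2 := h1.hasStrictFDerivAt_equiv (hne t ht)
  refine ⟨(h2.toOpenPartialHomeomorph f).source, (h2.toOpenPartialHomeomorph f).open_source,
    h2.mem_toOpenPartialHomeomorph_source, ?_⟩
  have := (h2.toOpenPartialHomeomorph f).injOn
  rwa [h2.toOpenPartialHomeomorph_coe] at this

/-- Banach indicatrix formula. -/
lemma jc_indicatrix (f f' : ℝ → ℝ) (O : Set ℝ) (hO : IsOpen O)
    (hd : ∀ t ∈ O, HasDerivAt f (f' t) t) (hne : ∀ t ∈ O, f' t ≠ 0) (hc : ContinuousOn f' O)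
    (P : Set ℝ) (hP : MeasurableSet P) (hPO : P ⊆ O) :
    ∃ N : ℝ → ℝ≥0∞, Measurable N ∧
      (∀ s, N s = Measure.count (P ∩ f ⁻¹' {s})) ∧
      ∫⁻ s, N s = ∫⁻ t in P, ENNReal.ofReal |f' t| := by
  rcases O.eq_empty_or_nonempty with hemp | hOne
  · have : P = ∅ := by rw [hemp] at hPO; exact subset_empty_iff.1 hPO
    subst this
    exact ⟨fun _ => 0, measurable_const, by simp, by simp⟩
  choose! V hVo hVm hVi using jc_locally_inj f f' O hO hd hne hc
  obtain ⟨T, hTO, hTc, hTcov⟩ := TopologicalSpace.countable_cover_nhdsWithin (f := V) (s := O)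
    (fun t ht => nhdsWithin_le_nhds ((hVo t ht).mem_nhds (hVm t ht)))
  have hTne : T.Nonempty := by
    obtain ⟨t, ht⟩ := hOne
    obtain ⟨u, hu, _⟩ := mem_iUnion₂.1 (hTcov ht)
    exact ⟨u, hu⟩
  obtain ⟨e, he⟩ := hTc.exists_eq_range hTne
  have heO : ∀ n, e n ∈ O := fun n => hTO (he ▸ mem_range_self n)
  set W : ℕ → Set ℝ := disjointed (fun n => V (e n)) with hW
  have hWm : ∀ n, MeasurableSet (W n) := fun n =>
    MeasurableSet.disjointed (fun n => (hVo _ (heO n)).measurableSet) n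
  have hWsub : ∀ n, W n ⊆ V (e n) := fun n => disjointed_subset _ n
  have hWdis : Pairwise (Function.onFun Disjoint W) := disjoint_disjointed _
  have hWcov : P ⊆ ⋃ n, W n := by
    rw [hW, iUnion_disjointed]
    intro t ht
    obtain ⟨u, hu, hu'⟩ := mem_iUnion₂.1 (hTcov (hPO ht))
    rw [he] at hu
    obtain ⟨n, rfl⟩ := hu
    exact mem_iUnion.2 ⟨n, hu'⟩
  set Q : ℕ → Set ℝ := fun n => P ∩ W n with hQ
  have hQm : ∀ n, MeasurableSet (Q n) := fun n => hP.inter (hWm n)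
  have hQdis : Pairwise (Function.onFun Disjoint Q) := fun i j hij =>
    (hWdis hij).mono inter_subset_right inter_subset_right
  have hQU : P = ⋃ n, Q n := by
    rw [hQ, ← inter_iUnion, inter_eq_left.2 hWcov]
  have hQinj : ∀ n, InjOn f (Q n) := fun n =>
    (hVi _ (heO n)).mono (inter_subset_right.trans (hWsub n))
  have hfc : ContinuousOn f O := fun t ht => (hd t ht).continuousAt.continuousWithinAt
  have hQO : ∀ n, Q n ⊆ O := fun n => inter_subset_left.trans hPO
  have him : ∀ n, MeasurableSet (f '' Q n) := fun n =>
    (hQm n).image_of_continuousOn_injOn (hfc.mono (hQO n)) (hQinj n)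
  have hmeas : ∀ n, Measurable ((f '' Q n).indicator (1 : ℝ → ℝ≥0∞)) := fun n =>
    measurable_one.indicator (him n)
  refine ⟨fun s => ∑' n, (f '' Q n).indicator (1 : ℝ → ℝ≥0∞) s, ?_, ?_, ?_⟩
  · exact Measurable.tsum hmeas
  · intro s
    have h1 : P ∩ f ⁻¹' {s} = ⋃ n, (Q n ∩ f ⁻¹' {s}) := by
      rw [← iUnion_inter, ← hQU]
    have hss : ∀ n, (Q n ∩ f ⁻¹' {s}).Subsingleton := by
      rintro n x ⟨hx, hx'⟩ y ⟨hy, hy'⟩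
      exact hQinj n hx hy (hx'.trans hy'.symm)
    rw [h1, measure_iUnion]
    · refine tsum_congr fun n => ?_
      by_cases hs : s ∈ f '' Q n
      · obtain ⟨t, ht, hts⟩ := id hs
        have : Q n ∩ f ⁻¹' {s} = {t} := (hss n).eq_singleton_of_mem ⟨ht, hts⟩
        rw [this, indicator_of_mem hs, Measure.count_singleton]; rfl
      · have : Q n ∩ f ⁻¹' {s} = ∅ := by
          rw [eq_empty_iff_forall_notMem]
          rintro x ⟨hx, hx'⟩
          exact hs ⟨x, hx, hx'⟩
        rw [this, indicator_of_notMem hs, measure_empty]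
    · exact fun i j hij => (hQdis hij).mono inter_subset_left inter_subset_left
    · exact fun n => (hss n).measurableSet
  · rw [lintegral_tsum fun n => (hmeas n).aemeasurable, hQU, lintegral_iUnion hQm hQdis]
    refine tsum_congr fun n => ?_
    rw [lintegral_indicator_one (him n)]
    have := lintegral_image_eq_lintegral_abs_deriv_mul (hQm n)
      (fun t ht => (hd t (hQO n ht)).hasDerivWithinAt) (hQinj n) (fun _ => 1)
    simpa using this

lemma jc_sard (f f' : ℝ → ℝ) (Z : Set ℝ) (hd : ∀ t ∈ Z, HasDerivWithinAt f (f' t) Z t)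
    (h0 : ∀ t ∈ Z, f' t = 0) : volume (f '' Z) = 0 := by
  apply addHaar_image_eq_zero_of_det_fderivWithin_eq_zero volume
    (f' := fun t => ContinuousLinearMap.toSpanSingleton ℝ (f' t))
    (fun t ht => (hd t ht).hasFDerivWithinAt)
  intro t ht
  simp [h0 t ht]

/-- Eilenberg type inequality for the projection on the real axis. -/
lemma jc_eilenberg (F : Set ℂ) (hF : IsClosed F) :
    ∃ N : ℝ → ℝ≥0∞, Measurable N ∧
      (∀ s, ∀ T : Finset ℝ, (∀ y ∈ T, (⟨s, y⟩ : ℂ) ∈ F) → (T.card : ℝ≥0∞) ≤ N s) ∧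
      ∫⁻ s, N s ≤ μH[(1 : ℝ)] F := by
  set S : ℕ → ℤ → Set ℂ := fun m j => {z : ℂ | ⌊((m : ℝ) + 1) * z.im⌋ = j} with hS
  have hSm : ∀ m j, MeasurableSet (S m j) := by
    intro m j
    have : Measurable fun z : ℂ => ⌊((m : ℝ) + 1) * z.im⌋ :=
      Int.measurable_floor.comp (Complex.measurable_im.const_mul _)
    exact this (measurableSet_singleton j)
  set M : ℕ → ℤ → Set ℝ := fun m j => toMeasurable volume (Complex.re '' (F ∩ S m j)) with hM
  have hmeas : ∀ m j, Measurable ((M m j).indicator (1 : ℝ → ℝ≥0∞)) := fun m j =>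
    measurable_one.indicator (measurableSet_toMeasurable _ _)
  set n : ℕ → ℝ → ℝ≥0∞ := fun m s => ∑' j, (M m j).indicator (1 : ℝ → ℝ≥0∞) s with hn
  have hnm : ∀ m, Measurable (n m) := fun m => Measurable.tsum (hmeas m)
  have hint : ∀ m, ∫⁻ s, n m s ≤ μH[(1 : ℝ)] F := by
    intro m
    rw [hn]
    simp only
    rw [lintegral_tsum fun j => (hmeas m j).aemeasurable]
    have h1 : F = ⋃ j, F ∩ S m j := by
      rw [← inter_iUnion, eq_comm, inter_eq_left]
      intro z _
      exact mem_iUnion.2 ⟨_, rfl⟩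
    have h2 : μH[(1 : ℝ)] F = ∑' j, μH[(1 : ℝ)] (F ∩ S m j) := by
      conv_lhs => rw [h1]
      apply measure_iUnion
      · intro i j hij
        apply Disjoint.mono inter_subset_right inter_subset_right
        rw [disjoint_left]
        rintro z (hz : _ = i) (hz' : _ = j)
        exact hij (hz.symm.trans hz')
      · exact fun j => hF.measurableSet.inter (hSm m j)
    rw [h2]
    refine ENNReal.tsum_le_tsum fun j => ?_
    rw [lintegral_indicator_one (measurableSet_toMeasurable _ _), measure_toMeasurable,
      ← hausdorffMeasure_real]
    have hlip : LipschitzWith 1 Complex.re :=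
      LipschitzWith.of_dist_le_mul fun z w => by
        simpa [Complex.dist_eq, Real.dist_eq] using Complex.abs_re_le_norm (z - w)
    simpa using hlip.hausdorffMeasure_image_le zero_le_one (F ∩ S m j)
  refine ⟨fun s => liminf (fun m => n m s) atTop, ?_, ?_, ?_⟩
  · exact Measurable.liminf hnm
  · intro s T hT
    apply le_liminf_of_le
    · isBoundedDefault
    have hev : ∀ᶠ m : ℕ in atTop, ∀ y ∈ T, ∀ y' ∈ T, y ≠ y' → 1 ≤ ((m : ℝ) + 1) * |y - y'| := by
      rw [Filter.eventually_all_finset]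
      intro y _
      rw [Filter.eventually_all_finset]
      intro y' _
      by_cases h : y = y'
      · exact Eventually.of_forall fun m h' => absurd h h'
      · have hpos : 0 < |y - y'| := abs_pos.2 (sub_ne_zero.2 h)
        obtain ⟨k, hk⟩ := exists_nat_ge (1 / |y - y'|)
        filter_upwards [eventually_ge_atTop k] with m hm _
        have : (k : ℝ) ≤ m := by exact_mod_cast hm
        rw [div_le_iff₀ hpos] at hk
        nlinarith
    filter_upwards [hev] with m hm
    have hinj : InjOn (fun y : ℝ => ⌊((m : ℝ) + 1) * y⌋) T := by
      intro y hy y' hy' h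
      by_contra hne
      have h1 := Int.abs_sub_lt_one_of_floor_eq_floor h
      rw [← mul_sub, abs_mul, abs_of_pos (by positivity)] at h1
      linarith [hm y hy y' hy' hne]
    rw [← Finset.card_image_of_injOn hinj, Finset.card_eq_sum_ones, Nat.cast_sum]
    refine le_trans (Finset.sum_le_sum (fun j hj => ?_)) (ENNReal.sum_le_tsum _)
    rw [Finset.mem_image] at hj
    obtain ⟨y, hy, rfl⟩ := hj
    rw [indicator_of_mem]
    · simp
    · apply subset_toMeasurable
      exact ⟨⟨s, y⟩, ⟨hT y hy, rfl⟩, rfl⟩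
  · refine (lintegral_liminf_le hnm).trans ?_
    refine (liminf_le_liminf (Eventually.of_forall hint)).trans ?_
    simp

/-- Vertical slice of a planar set. -/
def jcSlice (D : Set ℂ) (s : ℝ) : Set ℝ := {y : ℝ | (⟨s, y⟩ : ℂ) ∈ D}

lemma jc_clm_I (Λ : ℂ →L[ℝ] ℝ) (z : ℂ) : Λ z = z.re * Λ 1 + z.im * Λ Complex.I := by
  have : z = z.re • (1 : ℂ) + z.im • Complex.I := by
    apply Complex.ext <;> simp
  conv_lhs => rw [this]
  simp only [map_add, map_smul, smul_eq_mul]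

lemma jc_transverse (D U : Set ℂ) (u : ℂ → ℝ) (hU : IsOpen U) (hu : ContDiffOn ℝ 1 u U)
    (hDU : D ∩ U = {x ∈ U | u x ≤ 0}) (q : ℂ) (hqU : q ∈ U) (hq0 : u q = 0)
    (hI : fderiv ℝ u q Complex.I ≠ 0) :
    JcREnd (jcSlice D q.re) q.im ∨ JcLEnd (jcSlice D q.re) q.im := by
  have hdiff : HasFDerivAt u (fderiv ℝ u q) q :=
    ((hu.contDiffAt (hU.mem_nhds hqU)).differentiableAt one_ne_zero).hasFDerivAt
  have hline : HasDerivAt (fun y : ℝ => (⟨q.re, y⟩ : ℂ)) Complex.I q.im := by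
    have h1 : HasDerivAt (fun y : ℝ => (q.re : ℂ) + (y : ℂ) * Complex.I) (1 * Complex.I) q.im :=
      ((hasDerivAt_id q.im).ofReal_comp.mul_const Complex.I).const_add _
    rw [one_mul] at h1
    convert h1 using 2 with y
    apply Complex.ext <;> simp
  have hcomp : HasDerivAt (fun y : ℝ => u ⟨q.re, y⟩) (fderiv ℝ u q Complex.I) q.im :=
    HasFDerivAt.comp_hasDerivAt (l := u) q.im hdiff hline
  have hUev : ∀ᶠ y in 𝓝 q.im, (⟨q.re, y⟩ : ℂ) ∈ U :=
    hline.continuousAt.eventually_mem (hU.mem_nhds hqU)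
  have hmem : ∀ y : ℝ, (⟨q.re, y⟩ : ℂ) ∈ U → (y ∈ jcSlice D q.re ↔ u ⟨q.re, y⟩ ≤ 0) := by
    intro y hy
    have : (⟨q.re, y⟩ : ℂ) ∈ D ∩ U ↔ (⟨q.re, y⟩ : ℂ) ∈ {x ∈ U | u x ≤ 0} := by rw [hDU]
    constructor
    · intro h; exact (this.1 ⟨h, hy⟩).2
    · intro h; exact (this.2 ⟨hy, h⟩).1
  rcases lt_or_gt_of_ne hI with hlt | hgt
  · right
    have hn : HasDerivAt (fun y : ℝ => - u ⟨q.re, y⟩) (-(fderiv ℝ u q Complex.I)) q.im := hcomp.neg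
    have hs : ∀ᶠ y in 𝓝 q.im, SignType.sign (- u ⟨q.re, y⟩) = SignType.sign (y - q.im) :=
      eventually_nhdsWithin_sign_eq_of_deriv_pos (f := fun y : ℝ => - u ⟨q.re, y⟩) (x₀ := q.im)
      (by rw [hn.deriv]; linarith) (by simpa using hq0)
    constructor
    · filter_upwards [nhdsWithin_le_nhds hs, nhdsWithin_le_nhds hUev, self_mem_nhdsWithin]
        with y h1 h2 h3
      rw [hmem y h2, not_le]
      rw [sign_neg (a := y - q.im) (sub_neg.2 h3), sign_eq_neg_one_iff] at h1
      linarith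
    · filter_upwards [nhdsWithin_le_nhds hs, nhdsWithin_le_nhds hUev, self_mem_nhdsWithin]
        with y h1 h2 h3
      rw [hmem y h2]
      rw [sign_pos (a := y - q.im) (sub_pos.2 h3), sign_eq_one_iff] at h1
      linarith
  · left
    have hs : ∀ᶠ y in 𝓝 q.im, SignType.sign (u ⟨q.re, y⟩) = SignType.sign (y - q.im) :=
      eventually_nhdsWithin_sign_eq_of_deriv_pos (f := fun y : ℝ => u ⟨q.re, y⟩) (x₀ := q.im)
      (by rw [hcomp.deriv]; exact hgt) (by simpa using hq0)
    constructor
    · filter_upwards [nhdsWithin_le_nhds hs, nhdsWithin_le_nhds hUev, self_mem_nhdsWithin]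
        with y h1 h2 h3
      rw [hmem y h2]
      rw [sign_neg (a := y - q.im) (sub_neg.2 h3), sign_eq_neg_one_iff] at h1
      linarith
    · filter_upwards [nhdsWithin_le_nhds hs, nhdsWithin_le_nhds hUev, self_mem_nhdsWithin]
        with y h1 h2 h3
      rw [hmem y h2, not_le]
      rw [sign_pos (a := y - q.im) (sub_pos.2 h3), sign_eq_one_iff] at h1
      linarith

lemma jc_frontier_zero (D U : Set ℂ) (u : ℂ → ℝ) (hD : IsClosed D) (hU : IsOpen U)
    (hu : ContinuousOn u U) (hDU : D ∩ U = {x ∈ U | u x ≤ 0}) (q : ℂ) (hqU : q ∈ U)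
    (hq : q ∈ frontier D) : u q = 0 := by
  have hqD : q ∈ D := hD.frontier_subset hq
  have h1 : q ∈ {x ∈ U | u x ≤ 0} := hDU ▸ ⟨hqD, hqU⟩
  by_contra hne
  have hlt : u q < 0 := lt_of_le_of_ne h1.2 hne
  have hev : ∀ᶠ x in 𝓝 q, u x < 0 :=
    (hu.continuousAt (hU.mem_nhds hqU)).eventually_lt continuousAt_const hlt
  have : D ∈ 𝓝 q := by
    filter_upwards [hev, hU.mem_nhds hqU] with x hx hxU
    have : x ∈ D ∩ U := by rw [hDU]; exact ⟨hxU, hx.le⟩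
    exact this.1
  exact hq.2 (mem_interior_iff_mem_nhds.2 this)

lemma jc_local_null (T U : Set ℂ) (u : ℂ → ℝ) (hU : IsOpen U) (hu : ContDiffOn ℝ 1 u U)
    (hgrad : ∀ x ∈ U, fderiv ℝ u x ≠ 0) (hT0 : ∀ q ∈ T ∩ U, u q = 0)
    (hTI : ∀ q ∈ T ∩ U, fderiv ℝ u q Complex.I = 0) (p₀ : ℂ) (hp₀ : p₀ ∈ T ∩ U) :
    ∃ V ∈ 𝓝 p₀, volume (Complex.re '' (T ∩ V)) = 0 := by
  have hone : ∀ q ∈ T ∩ U, fderiv ℝ u q 1 ≠ 0 := by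
    intro q hq h
    apply hgrad q hq.2
    ext z
    rw [jc_clm_I, h, hTI q hq]; simp
  set c := fderiv ℝ u p₀ 1 with hc
  have hc0 : 0 < |c| := abs_pos.2 (hone p₀ hp₀)
  have hstrict : HasStrictFDerivAt u (fderiv ℝ u p₀) p₀ :=
    (hu.contDiffAt (hU.mem_nhds hp₀.2)).hasStrictFDerivAt one_ne_zero
  have hev := hstrict.isLittleO.def (half_pos hc0)
  rw [nhds_prod_eq] at hev
  obtain ⟨V₁, hV₁, V₂, hV₂, hVV⟩ := mem_prod_iff.1 hev
  set V₀ := V₁ ∩ V₂ with hV₀def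
  have hV₀ : V₀ ∈ 𝓝 p₀ := inter_mem hV₁ hV₂
  have hV : ∀ p ∈ V₀, ∀ q ∈ V₀,
      ‖u p - u q - (fderiv ℝ u p₀) (p - q)‖ ≤ |c| / 2 * ‖p - q‖ :=
    fun p hp q hq => hVV (a := (p, q)) ⟨hp.1, hq.2⟩
  refine ⟨V₀ ∩ U, inter_mem hV₀ (hU.mem_nhds hp₀.2), ?_⟩
  set S := T ∩ (V₀ ∩ U) with hS
  have hST : ∀ q ∈ S, q ∈ T ∩ U := fun q hq => ⟨hq.1, hq.2.2⟩
  have hlip : ∀ p ∈ S, ∀ q ∈ S, |p.re - q.re| ≤ |p.im - q.im| := by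
    intro p hp q hq
    have h1 := hV p hp.2.1 q hq.2.1
    simp only [hT0 p (hST p hp), hT0 q (hST q hq)] at h1
    rw [jc_clm_I, hTI p₀ hp₀] at h1
    simp only [Complex.sub_re, mul_zero, add_zero, sub_self, zero_sub, norm_neg,
      Real.norm_eq_abs, abs_mul] at h1
    have h2 := Complex.norm_le_abs_re_add_abs_im (p - q)
    simp only [Complex.sub_re, Complex.sub_im] at h2
    nlinarith
  have hinj : InjOn Complex.im S := by
    intro p hp q hq h
    have := hlip p hp q hq
    rw [h, sub_self, abs_zero] at this
    have := abs_eq_zero.1 (le_antisymm this (abs_nonneg _))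
    exact Complex.ext (sub_eq_zero.1 this) h
  set h : ℝ → ℝ := fun y => (Function.invFunOn Complex.im S y).re with hh
  have hhq : ∀ q ∈ S, h q.im = q.re := by
    intro q hq
    simp only [hh]
    rw [hinj.leftInvOn_invFunOn hq]
  have himage : Complex.re '' S = h '' (Complex.im '' S) := by
    rw [image_image]
    exact image_congr fun q hq => (hhq q hq).symm
  rw [himage]
  apply jc_sard h (fun _ => 0) _ _ (fun _ _ => rfl)
  rintro _ ⟨p, hp, rfl⟩
  rw [hasDerivWithinAt_iff_isLittleO, Asymptotics.isLittleO_iff]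
  intro ε hε
  have hcp : 0 < |fderiv ℝ u p 1| := abs_pos.2 (hone p (hST p hp))
  have hdiff : HasFDerivAt u (fderiv ℝ u p) p :=
    ((hu.contDiffAt (hU.mem_nhds hp.2.2)).differentiableAt one_ne_zero).hasFDerivAt
  have hev := (hasFDerivAt_iff_isLittleO.1 hdiff).def
    (show 0 < ε * |fderiv ℝ u p 1| / 2 by positivity)
  obtain ⟨δ, hδ, hball⟩ := Metric.eventually_nhds_iff.1 hev
  have hnear : ∀ᶠ y in 𝓝[Complex.im '' S] p.im, |y - p.im| < δ / 2 := by
    apply nhdsWithin_le_nhds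
    exact Metric.ball_mem_nhds p.im (half_pos hδ)
  filter_upwards [hnear, self_mem_nhdsWithin] with y hy hyS
  obtain ⟨q, hq, rfl⟩ := hyS
  rw [hhq q hq, hhq p hp]
  simp only [smul_zero, sub_zero, Real.norm_eq_abs]
  have h2 := Complex.norm_le_abs_re_add_abs_im (q - p)
  simp only [Complex.sub_re, Complex.sub_im] at h2
  have h3 := hlip q hq p hp
  have h4 := hball (y := q) (by rw [dist_eq_norm]; linarith)
  simp only [hT0 p (hST p hp), hT0 q (hST q hq)] at h4
  rw [jc_clm_I, hTI p (hST p hp)] at h4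
  simp only [Complex.sub_re, mul_zero, add_zero, sub_self, zero_sub, norm_neg,
      Real.norm_eq_abs, abs_mul] at h4
  have h5 : |q.re - p.re| * |fderiv ℝ u p 1| ≤ ε * |q.im - p.im| * |fderiv ℝ u p 1| := by
    calc _ ≤ _ := h4
      _ ≤ ε * |fderiv ℝ u p 1| / 2 * (2 * |q.im - p.im|) := by gcongr; linarith
      _ = _ := by ring
  exact le_of_mul_le_mul_right h5 hcp

/-- Regularity of a planar closed domain. -/
def JcReg (D : Set ℂ) : Prop := ∀ p ∈ frontier D, ∃ U : Set ℂ, IsOpen U ∧ p ∈ U ∧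
  ∃ u : ℂ → ℝ, ContDiffOn ℝ 1 u U ∧ (∀ x ∈ U, fderiv ℝ u x ≠ 0) ∧ D ∩ U = {x ∈ U | u x ≤ 0}

lemma jc_tangent_null (D : Set ℂ) (hD : IsClosed D) (hreg : JcReg D) :
    ∀ᵐ s : ℝ, ∀ y : ℝ, (⟨s, y⟩ : ℂ) ∈ frontier D →
      JcREnd (jcSlice D s) y ∨ JcLEnd (jcSlice D s) y := by
  set T : Set ℂ := {p | p ∈ frontier D ∧
    ¬ (JcREnd (jcSlice D p.re) p.im ∨ JcLEnd (jcSlice D p.re) p.im)} with hT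
  have hloc : ∀ p ∈ T, ∃ V ∈ 𝓝 p, volume (Complex.re '' (T ∩ V)) = 0 := by
    intro p hp
    obtain ⟨U, hU, hpU, u, hu, hgrad, hDU⟩ := hreg p hp.1
    have h0 : ∀ q ∈ T ∩ U, u q = 0 := fun q hq =>
      jc_frontier_zero D U u hD hU hu.continuousOn hDU q hq.2 hq.1.1
    apply jc_local_null T U u hU hu hgrad h0 ?_ p ⟨hp, hpU⟩
    intro q hq
    by_contra hI
    exact hq.1.2 (jc_transverse D U u hU hu hDU q hq.2 (h0 q hq) hI)
  choose! V hVn hV0 using hloc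
  obtain ⟨t, htT, htc, hcov⟩ := TopologicalSpace.countable_cover_nhdsWithin (f := V) (s := T)
    (fun p hp => nhdsWithin_le_nhds (hVn p hp))
  have hnull : volume (Complex.re '' T) = 0 := by
    have hsub : Complex.re '' T ⊆ ⋃ p ∈ t, Complex.re '' (T ∩ V p) := by
      rintro _ ⟨q, hq, rfl⟩
      obtain ⟨p, hp, hqp⟩ := mem_iUnion₂.1 (hcov hq)
      exact mem_iUnion₂.2 ⟨p, hp, q, ⟨hq, hqp⟩, rfl⟩
    refine measure_mono_null hsub ?_
    rw [measure_biUnion_null_iff htc]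
    exact fun p hp => hV0 p (htT hp)
  rw [ae_iff]
  refine measure_mono_null ?_ hnull
  intro s hs
  simp only [mem_ofPred_eq, not_forall] at hs
  obtain ⟨y, hy, hy'⟩ := hs
  exact ⟨⟨s, y⟩, ⟨hy, hy'⟩, rfl⟩

lemma jc_dichotomy (D S : Set ℂ) (hS : IsPreconnected S) (hd : Disjoint S (frontier D)) :
    S ⊆ D ∨ S ⊆ Dᶜ := by
  have hsub : S ⊆ interior D ∪ (closure D)ᶜ := by
    intro z hz
    by_cases h : z ∈ closure D
    · left
      by_contra h'
      exact disjoint_left.1 hd hz ⟨h, h'⟩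
    · exact Or.inr h
  have hdis : Disjoint (interior D) (closure D)ᶜ := by
    rw [disjoint_left]
    intro z hz hz'
    exact hz' (subset_closure (interior_subset hz))
  rcases hS.subset_or_subset isOpen_interior isClosed_closure.isOpen_compl hdis hsub with h | h
  · exact Or.inl (h.trans interior_subset)
  · exact Or.inr (h.trans (compl_subset_compl.2 subset_closure))

lemma jc_proj_finite (F : Set ℂ) (hF : μH[(1 : ℝ)] F < ⊤) (π : ℂ → ℝ) (hπ : LipschitzWith 1 π)
    (S : Set ℝ) (hS : volume S = ⊤) : ∃ s ∈ S, s ∉ π '' F := by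
  by_contra hcon
  push Not at hcon
  have h1 : volume S ≤ volume (π '' F) := measure_mono hcon
  have h2 : volume (π '' F) ≤ μH[(1 : ℝ)] F := by
    rw [← hausdorffMeasure_real]
    simpa using hπ.hausdorffMeasure_image_le zero_le_one F
  rw [hS] at h1
  exact absurd (h1.trans h2) (not_le.2 hF)

lemma jc_lip_re : LipschitzWith 1 Complex.re :=
  LipschitzWith.of_dist_le_mul fun z w => by
    simpa [Complex.dist_eq, Real.dist_eq] using Complex.abs_re_le_norm (z - w)

lemma jc_lip_im : LipschitzWith 1 Complex.im :=
  LipschitzWith.of_dist_le_mul fun z w => by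
    simpa [Complex.dist_eq, Real.dist_eq] using Complex.abs_im_le_norm (z - w)

lemma jc_status (D : Set ℂ) (hF : μH[(1 : ℝ)] (frontier D) < ⊤) :
    ∃ A : Set ℂ, (A = D ∨ A = Dᶜ) ∧
      (∀ s y, ∃ z, z ∉ jcSlice A s ∧ y < z) ∧ (∀ s y, ∃ z, z ∉ jcSlice A s ∧ z < y) := by
  obtain ⟨s₀, -, hs₀⟩ := jc_proj_finite _ hF _ jc_lip_re univ Real.volume_univ
  have hcre : ∀ s : ℝ, Convex ℝ {z : ℂ | z.re = s} := fun s => by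
    have := (convex_singleton s).linear_preimage Complex.reLm
    exact this
  have hcim : ∀ s : ℝ, Convex ℝ {z : ℂ | z.im = s} := fun s => by
    have := (convex_singleton s).linear_preimage Complex.imLm
    exact this
  obtain ⟨A, hA, hAs⟩ : ∃ A : Set ℂ, (A = D ∨ A = Dᶜ) ∧ {z : ℂ | z.re = s₀} ⊆ Aᶜ := by
    rcases jc_dichotomy D {z : ℂ | z.re = s₀} (hcre s₀).isPreconnected (by
      rw [disjoint_left]
      intro z hz hz'
      exact hs₀ ⟨z, hz', hz⟩) with h | h
    · exact ⟨Dᶜ, Or.inr rfl, by rwa [compl_compl]⟩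
    · exact ⟨D, Or.inl rfl, h⟩
  have hfr : frontier A = frontier D := by
    rcases hA with rfl | rfl
    · rfl
    · rw [frontier_compl]
  have hhor : ∀ y ∉ Complex.im '' frontier D, ∀ s, y ∉ jcSlice A s := by
    intro y hy s hs
    rcases jc_dichotomy A {z : ℂ | z.im = y} (hcim y).isPreconnected (by
      rw [disjoint_left, hfr]
      intro z hz hz'
      exact hy ⟨z, hz', hz⟩) with h | h
    · exact hAs (show (⟨s₀, y⟩ : ℂ) ∈ {z : ℂ | z.re = s₀} from rfl)
        (h (show (⟨s₀, y⟩ : ℂ) ∈ {z : ℂ | z.im = y} from rfl))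
    · exact h (show (⟨s, y⟩ : ℂ) ∈ {z : ℂ | z.im = y} from rfl) hs
  refine ⟨A, hA, fun s y => ?_, fun s y => ?_⟩
  · obtain ⟨z, hz, hz'⟩ := jc_proj_finite _ hF _ jc_lip_im (Ioi y) Real.volume_Ioi
    exact ⟨z, hhor z hz' s, hz⟩
  · obtain ⟨z, hz, hz'⟩ := jc_proj_finite _ hF _ jc_lip_im (Iio y) Real.volume_Iio
    exact ⟨z, hhor z hz' s, hz⟩

lemma jc_tri (D A : Set ℂ) (hD : IsClosed D) (hreg : JcReg D) (hA : A = D ∨ A = Dᶜ) :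
    ∀ᵐ s : ℝ, ∀ y, jcSlice A s ∈ 𝓝 y ∨ (jcSlice A s)ᶜ ∈ 𝓝 y ∨
      JcREnd (jcSlice A s) y ∨ JcLEnd (jcSlice A s) y := by
  filter_upwards [jc_tangent_null D hD hreg] with s hs y
  have hcont : Continuous (fun y : ℝ => (⟨s, y⟩ : ℂ)) := by
    have : (fun y : ℝ => (⟨s, y⟩ : ℂ)) = fun y : ℝ => (s : ℂ) + (y : ℂ) * Complex.I := by
      ext y; apply Complex.ext <;> simp
    rw [this]; fun_prop
  have hmain : jcSlice D s ∈ 𝓝 y ∨ (jcSlice D s)ᶜ ∈ 𝓝 y ∨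
      JcREnd (jcSlice D s) y ∨ JcLEnd (jcSlice D s) y := by
    by_cases hy : (⟨s, y⟩ : ℂ) ∈ frontier D
    · exact Or.inr (Or.inr (hs y hy))
    · by_cases hcl : (⟨s, y⟩ : ℂ) ∈ D
      · left
        have : (⟨s, y⟩ : ℂ) ∈ interior D := by
          by_contra h
          exact hy ⟨subset_closure hcl, h⟩
        exact hcont.continuousAt (mem_interior_iff_mem_nhds.1 this)
      · right; left
        exact hcont.continuousAt (hD.isOpen_compl.mem_nhds hcl)
  rcases hA with rfl | rfl
  · exact hmain
  · have h1 : jcSlice Dᶜ s = (jcSlice D s)ᶜ := rfl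
    rw [h1, compl_compl]
    rcases hmain with h | h | h | h
    · exact Or.inr (Or.inl h)
    · exact Or.inl h
    · refine Or.inr (Or.inr (Or.inr ⟨?_, ?_⟩))
      · filter_upwards [h.1] with w hw; simpa using hw
      · filter_upwards [h.2] with w hw; simpa using hw
    · refine Or.inr (Or.inr (Or.inl ⟨?_, ?_⟩))
      · filter_upwards [h.1] with w hw; simpa using hw
      · filter_upwards [h.2] with w hw; simpa using hw

/-- Between two consecutive left-to-right crossings there is a right-to-left crossing. -/
lemma jc_interleave (γ γ' : ℝ → ℂ) (τ : ℝ) (hd : ∀ t ∈ Ioo 0 τ, HasDerivAt γ (γ' t) t)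
    (hc' : Continuous γ') (hc : Continuous γ) (hcl : γ τ = γ 0)
    (hinj : InjOn γ (Ico 0 τ)) (s : ℝ) (hs0 : (γ 0).re ≠ s)
    (hsreg : ∀ t ∈ Ioo 0 τ, (γ t).re = s → (γ' t).re ≠ 0) (P Q : Finset ℝ)
    (hP : ∀ y, y ∈ P ↔ ∃ t ∈ Ioo 0 τ, γ t = ⟨s, y⟩ ∧ 0 < (γ' t).re)
    (hQ : ∀ y, y ∈ Q ↔ ∃ t ∈ Ioo 0 τ, γ t = ⟨s, y⟩ ∧ (γ' t).re < 0) :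
    ∀ y ∈ P, ∀ y' ∈ P, y < y' → ∃ z ∈ Q, y < z ∧ z < y' := by
  intro y hy y' hy' hlt
  by_contra hcon
  push Not at hcon
  obtain ⟨w, hw, hwmin⟩ := (P.filter (y < ·)).exists_min_image id ⟨y', by simp [hy', hlt]⟩
  simp only [Finset.mem_filter, id] at hw hwmin
  have hwy' : w ≤ y' := hwmin y' ⟨hy', hlt⟩
  obtain ⟨t₁, ht₁, hγ₁, hp₁⟩ := (hP y).1 hy
  obtain ⟨t₂, ht₂, hγ₂, hp₂⟩ := (hP w).1 hw.1
  have hbetween : ∀ t ∈ Icc 0 τ, ∀ z : ℝ, γ t = ⟨s, z⟩ → y < z → z < w → False := by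
    intro t ht z hz h1 h2
    have ht' : t ∈ Ioo 0 τ := by
      refine ⟨lt_of_le_of_ne ht.1 ?_, lt_of_le_of_ne ht.2 ?_⟩
      · rintro rfl; apply hs0; rw [hz]
      · rintro rfl; apply hs0; rw [← hcl, hz]
    rcases lt_or_gt_of_ne (hsreg t ht' (by rw [hz])) with h | h
    · have hzQ : z ∈ Q := (hQ z).2 ⟨t, ht', hz, h⟩
      have := hcon z hzQ h1
      linarith
    · have hzP : z ∈ P := (hP z).2 ⟨t, ht', hz, h⟩
      have := hwmin z ⟨hzP, h1⟩
      linarith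
  have hseg : ∀ t ∈ Icc 0 τ, γ t ∉ openSegment ℝ (γ t₁) (γ t₂) := by
    intro t ht hmem
    obtain ⟨p, q, hp, hq, hpq, h⟩ := hmem
    have h2 : γ t = ⟨s, p * y + q * w⟩ := by
      rw [← h, hγ₁, hγ₂]
      apply Complex.ext
      · simp [← add_mul, hpq]
      · simp
    apply hbetween t ht _ h2
    · have : p = 1 - q := by linarith
      subst this; nlinarith [hw.2]
    · have : q = 1 - p := by linarith
      subst this; nlinarith [hw.2]
  have hne : t₁ ≠ t₂ := by
    rintro rfl
    rw [hγ₁] at hγ₂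
    have := congrArg Complex.im hγ₂
    simp only at this
    linarith [hw.2]
  rcases lt_or_gt_of_ne hne with h | h
  · exact jc_core γ γ' τ hd hc'.continuousOn hc.continuousOn hcl hinj t₁ t₂ ht₁.1 h ht₂.2 s
      (by rw [hγ₁]) (by rw [hγ₂]) hp₁ hp₂ hseg
  · exact jc_core γ γ' τ hd hc'.continuousOn hc.continuousOn hcl hinj t₂ t₁ ht₂.1 h ht₁.2 s
      (by rw [hγ₂]) (by rw [hγ₁]) hp₂ hp₁ (by rw [openSegment_symm]; exact hseg)

open Classical in
/-- Pointwise crossing count bound. -/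
lemma jc_pointwise (γ γ' : ℝ → ℂ) (τ : ℝ) (hd : ∀ t ∈ Ioo 0 τ, HasDerivAt γ (γ' t) t)
    (hc' : Continuous γ') (hc : Continuous γ) (hcl : γ τ = γ 0)
    (hinj : InjOn γ (Ico 0 τ)) (A : Set ℂ) (s : ℝ) (hs0 : (γ 0).re ≠ s)
    (hsreg : ∀ t ∈ Ioo 0 τ, (γ t).re = s → (γ' t).re ≠ 0)
    (hfin : {t | t ∈ Ioo 0 τ ∧ (γ t).re = s}.Finite)
    (htri : ∀ y, jcSlice A s ∈ 𝓝 y ∨ (jcSlice A s)ᶜ ∈ 𝓝 y ∨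
      JcREnd (jcSlice A s) y ∨ JcLEnd (jcSlice A s) y)
    (hup : ∀ y, ∃ z, z ∉ jcSlice A s ∧ y < z) (hdown : ∀ y, ∃ z, z ∉ jcSlice A s ∧ z < y)
    (H : Finset ℝ) (hH : ∀ y, (⟨s, y⟩ : ℂ) ∈ frontier A → y ∈ H) :
    2 * Measure.count ({t | t ∈ Ioo 0 τ ∧ 0 < (γ' t).re ∧ γ t ∈ A} ∩ (fun t => (γ t).re) ⁻¹' {s}) ≤
    2 * Measure.count ({t | t ∈ Ioo 0 τ ∧ (γ' t).re < 0 ∧ γ t ∈ A} ∩ (fun t => (γ t).re) ⁻¹' {s})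
      + (H.card : ℝ≥0∞) := by
  set C := hfin.toFinset with hC
  have hCm : ∀ t, t ∈ C ↔ t ∈ Ioo 0 τ ∧ (γ t).re = s := fun t => by simp [hC]
  set P := (C.filter (fun t => 0 < (γ' t).re)).image (fun t => (γ t).im) with hP
  set Q := (C.filter (fun t => (γ' t).re < 0)).image (fun t => (γ t).im) with hQ
  have hinjC : InjOn (fun t => (γ t).im) (C : Set ℝ) := by
    intro t ht r hr h
    have ht := (hCm t).1 ht
    have hr := (hCm r).1 hr
    exact hinj (Ioo_subset_Ico_self ht.1) (Ioo_subset_Ico_self hr.1)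
      (Complex.ext (ht.2.trans hr.2.symm) h)
  have hI := jc_interleave γ γ' τ hd hc' hc hcl hinj s hs0 hsreg P Q
    (fun y => by
      simp only [hP, Finset.mem_image, Finset.mem_filter, hCm]
      constructor
      · rintro ⟨t, ⟨⟨h1, h2⟩, h3⟩, h4⟩
        exact ⟨t, h1, Complex.ext h2 h4, h3⟩
      · rintro ⟨t, h1, h2, h3⟩
        exact ⟨t, ⟨⟨h1, by rw [h2]⟩, h3⟩, by rw [h2]⟩)
    (fun y => by
      simp only [hQ, Finset.mem_image, Finset.mem_filter, hCm]
      constructor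
      · rintro ⟨t, ⟨⟨h1, h2⟩, h3⟩, h4⟩
        exact ⟨t, h1, Complex.ext h2 h4, h3⟩
      · rintro ⟨t, h1, h2, h3⟩
        exact ⟨t, ⟨⟨h1, by rw [h2]⟩, h3⟩, by rw [h2]⟩)
  have hcont : Continuous (fun y : ℝ => (⟨s, y⟩ : ℂ)) := by
    have : (fun y : ℝ => (⟨s, y⟩ : ℂ)) = fun y : ℝ => (s : ℂ) + (y : ℂ) * Complex.I := by
      ext y; apply Complex.ext <;> simp
    rw [this]; fun_prop
  have hends : ∀ y, JcREnd (jcSlice A s) y ∨ JcLEnd (jcSlice A s) y → y ∈ H := by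
    intro y hy
    apply hH
    by_contra hfr
    have hor : jcSlice A s ∈ 𝓝 y ∨ (jcSlice A s)ᶜ ∈ 𝓝 y := by
      by_cases hcl : (⟨s, y⟩ : ℂ) ∈ closure A
      · left
        have : (⟨s, y⟩ : ℂ) ∈ interior A := by
          by_contra h
          exact hfr ⟨hcl, h⟩
        exact hcont.continuousAt (mem_interior_iff_mem_nhds.1 this)
      · right
        have := hcont.continuousAt (isClosed_closure.isOpen_compl.mem_nhds hcl)
        exact mem_of_superset this (fun w hw h => hw (subset_closure h))
    have hex : (∃ᶠ w in 𝓝 y, w ∈ jcSlice A s) ∧ (∃ᶠ w in 𝓝 y, w ∉ jcSlice A s) := by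
      rcases hy with h | h
      · exact ⟨h.1.frequently.filter_mono nhdsWithin_le_nhds,
          h.2.frequently.filter_mono nhdsWithin_le_nhds⟩
      · exact ⟨h.2.frequently.filter_mono nhdsWithin_le_nhds,
          h.1.frequently.filter_mono nhdsWithin_le_nhds⟩
    rcases hor with h | h
    · exact hex.2 (by filter_upwards [h] with w hw; simpa using hw)
    · exact hex.1 (by filter_upwards [h] with w hw; simpa using hw)
  have hcomb := jc_comb (jcSlice A s) htri hup hdown P Q hI H hends
  have hcount : ∀ (p : ℝ → Prop), Measure.count
      ({t | t ∈ Ioo 0 τ ∧ p t ∧ γ t ∈ A} ∩ (fun t => (γ t).re) ⁻¹' {s}) =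
      ((((C.filter p).image (fun t => (γ t).im)).filter (· ∈ jcSlice A s)).card : ℝ≥0∞) := by
    intro p
    rw [Finset.filter_image, Finset.card_image_of_injOn (hinjC.mono (by
      intro t ht
      simp only [Finset.coe_filter, Finset.mem_filter, mem_ofPred_eq] at ht
      exact ht.1.1)), ← Measure.count_apply_finset]
    congr 1
    ext t
    simp only [mem_inter_iff, mem_ofPred_eq, mem_preimage, mem_singleton_iff, Finset.coe_filter,
      Finset.mem_filter, hCm]
    have : (γ t).re = s → ((γ t).im ∈ jcSlice A s ↔ γ t ∈ A) := by
      intro h; subst h; exact Iff.rfl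
    tauto
  rw [hcount (fun t => 0 < (γ' t).re), hcount (fun t => (γ' t).re < 0)]
  exact_mod_cast hcomb

/-- One-sided bound for a set whose slices are bounded. -/
lemma jc_half (γ γ' : ℝ → ℂ) (τ : ℝ) (hτ : 0 < τ) (hd : ∀ t ∈ Ioo 0 τ, HasDerivAt γ (γ' t) t)
    (hc' : Continuous γ') (hc : Continuous γ) (hcl : γ τ = γ 0)
    (hinj : InjOn γ (Ico 0 τ)) (A : Set ℂ) (hAm : MeasurableSet A)
    (hfr : μH[(1 : ℝ)] (frontier A) < ⊤)
    (htri : ∀ᵐ s : ℝ, ∀ y, jcSlice A s ∈ 𝓝 y ∨ (jcSlice A s)ᶜ ∈ 𝓝 y ∨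
      JcREnd (jcSlice A s) y ∨ JcLEnd (jcSlice A s) y)
    (hup : ∀ s y, ∃ z, z ∉ jcSlice A s ∧ y < z) (hdown : ∀ s y, ∃ z, z ∉ jcSlice A s ∧ z < y) :
    ∫ t in (0 : ℝ)..τ, (γ ⁻¹' A).indicator (fun t => (γ' t).re) t ≤
      (μH[(1 : ℝ)] (frontier A)).toReal / 2 := by
  set f : ℝ → ℝ := fun t => (γ t).re with hf
  set f' : ℝ → ℝ := fun t => (γ' t).re with hf'
  have hf'c : Continuous f' := Complex.continuous_re.comp hc'
  have hfd : ∀ t ∈ Ioo 0 τ, HasDerivAt f (f' t) t := fun t ht =>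
    Complex.reCLM.hasFDerivAt.comp_hasDerivAt t (hd t ht)
  set O : Set ℝ := {t | t ∈ Ioo 0 τ ∧ f' t ≠ 0} with hO
  have hOo : IsOpen O := isOpen_Ioo.inter (isOpen_ne_fun hf'c continuous_const)
  set Pp : Set ℝ := {t | t ∈ Ioo 0 τ ∧ 0 < f' t ∧ γ t ∈ A} with hPp
  set Pm : Set ℝ := {t | t ∈ Ioo 0 τ ∧ f' t < 0 ∧ γ t ∈ A} with hPm
  have hγA : MeasurableSet (γ ⁻¹' A) := hc.measurable hAm
  have hPpm : MeasurableSet Pp := measurableSet_Ioo.inter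
    ((isOpen_lt continuous_const hf'c).measurableSet.inter hγA)
  have hPmm : MeasurableSet Pm := measurableSet_Ioo.inter
    ((isOpen_lt hf'c continuous_const).measurableSet.inter hγA)
  have hfdO : ∀ t ∈ O, HasDerivAt f (f' t) t := fun t ht => hfd t ht.1
  have hneO : ∀ t ∈ O, f' t ≠ 0 := fun t ht => ht.2
  obtain ⟨NO, hNOm, hNO, hNOi⟩ := jc_indicatrix f f' O hOo hfdO hneO hf'c.continuousOn O
    hOo.measurableSet Subset.rfl
  obtain ⟨Np, hNpm, hNp, hNpi⟩ := jc_indicatrix f f' O hOo hfdO hneO hf'c.continuousOn Pp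
    hPpm (fun t ht => ⟨ht.1, ht.2.1.ne'⟩)
  obtain ⟨Nm, hNmm, hNm, hNmi⟩ := jc_indicatrix f f' O hOo hfdO hneO hf'c.continuousOn Pm
    hPmm (fun t ht => ⟨ht.1, ht.2.1.ne⟩)
  obtain ⟨n, hnm, hn, hni⟩ := jc_eilenberg (frontier A) isClosed_frontier
  have hintf' : IntegrableOn f' (Ioo 0 τ) :=
    (hf'c.integrableOn_Icc (a := 0) (b := τ)).mono_set Ioo_subset_Icc_self
  have hfinI : ∫⁻ t in Ioo 0 τ, ENNReal.ofReal |f' t| < ⊤ := by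
    have := hintf'.norm.2
    rw [hasFiniteIntegral_iff_norm] at this
    simpa using this
  have hfinsub : ∀ S : Set ℝ, S ⊆ Ioo 0 τ → ∫⁻ t in S, ENNReal.ofReal |f' t| < ⊤ := fun S hS =>
    (lintegral_mono_set hS).trans_lt hfinI
  have hae1 : ∀ᵐ s : ℝ, NO s < ⊤ := by
    apply ae_lt_top hNOm
    rw [hNOi]
    exact (hfinsub O fun t ht => ht.1).ne
  have hae2 : ∀ᵐ s : ℝ, s ∉ f '' {t | t ∈ Ioo 0 τ ∧ f' t = 0} := by
    have := jc_sard f f' {t | t ∈ Ioo 0 τ ∧ f' t = 0}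
      (fun t ht => (hfd t ht.1).hasDerivWithinAt) (fun t ht => ht.2)
    exact measure_eq_zero_iff_ae_notMem.1 this
  have hae3 : ∀ᵐ s : ℝ, s ≠ f 0 := by
    rw [ae_iff]; simp
  have hpt : ∀ᵐ s : ℝ, 2 * Np s ≤ 2 * Nm s + n s := by
    filter_upwards [hae1, hae2, hae3, htri] with s h1 h2 h3 h4
    by_cases hns : n s = ⊤
    · rw [hns]; simp
    have hHfin : {y : ℝ | (⟨s, y⟩ : ℂ) ∈ frontier A}.Finite := by
      by_contra hinf
      obtain ⟨k, hk⟩ := ENNReal.exists_nat_gt hns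
      obtain ⟨T, hT, hTk⟩ := Set.Infinite.exists_subset_card_eq hinf k
      have := hn s T (fun y hy => hT hy)
      rw [hTk] at this
      exact absurd this (not_le.2 hk)
    have hreg : ∀ t ∈ Ioo 0 τ, (γ t).re = s → (γ' t).re ≠ 0 := fun t ht hts h0 =>
      h2 ⟨t, ⟨ht, h0⟩, hts⟩
    have hfin : {t | t ∈ Ioo 0 τ ∧ (γ t).re = s}.Finite := by
      rw [hNO s, Measure.count_apply_lt_top] at h1
      refine h1.subset ?_
      rintro t ⟨ht, hts⟩
      exact ⟨⟨ht, hreg t ht hts⟩, hts⟩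
    have := jc_pointwise γ γ' τ hd hc' hc hcl hinj A s h3.symm hreg hfin h4 (hup s) (hdown s)
      hHfin.toFinset (fun y hy => by simpa using hy)
    rw [hNp, hNm]
    refine this.trans ?_
    gcongr
    exact hn s _ (fun y hy => by simpa using hy)
  have hle : 2 * ∫⁻ t in Pp, ENNReal.ofReal |f' t| ≤
      2 * (∫⁻ t in Pm, ENNReal.ofReal |f' t|) + μH[(1 : ℝ)] (frontier A) := by
    rw [← hNpi, ← hNmi, ← lintegral_const_mul _ hNpm, ← lintegral_const_mul _ hNmm]
    refine (lintegral_mono_ae hpt).trans ?_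
    rw [lintegral_add_left (hNmm.const_mul _)]
    gcongr
  have hpf : ∫⁻ t in Pp, ENNReal.ofReal |f' t| ≠ ⊤ := (hfinsub Pp fun t ht => ht.1).ne
  have hmf : ∫⁻ t in Pm, ENNReal.ofReal |f' t| ≠ ⊤ := (hfinsub Pm fun t ht => ht.1).ne
  have hint : ∫ t in (0 : ℝ)..τ, (γ ⁻¹' A).indicator f' t =
      (∫⁻ t in Pp, ENNReal.ofReal |f' t|).toReal - (∫⁻ t in Pm, ENNReal.ofReal |f' t|).toReal := by
    rw [intervalIntegral.integral_of_le hτ.le, integral_Ioc_eq_integral_Ioo,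
      integral_eq_lintegral_pos_part_sub_lintegral_neg_part (hintf'.indicator hγA)]
    rw [← lintegral_indicator measurableSet_Ioo, ← lintegral_indicator measurableSet_Ioo,
      ← lintegral_indicator hPpm, ← lintegral_indicator hPmm]
    congr 3
    · ext t
      by_cases h1 : t ∈ Ioo 0 τ
      · by_cases h2 : γ t ∈ A
        · have h2' : t ∈ γ ⁻¹' A := h2
          by_cases h3 : 0 < f' t
          · have : t ∈ Pp := ⟨h1, h3, h2⟩
            simp [h1, h2', this, abs_of_pos h3]
          · have : t ∉ Pp := fun h => h3 h.2.1
            simp [h1, h2', this, not_lt.1 h3]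
        · have h2' : t ∉ γ ⁻¹' A := h2
          have : t ∉ Pp := fun h => h2 h.2.2
          simp [h2', this]
      · have : t ∉ Pp := fun h => h1 h.1
        simp only [indicator_of_notMem h1, indicator_of_notMem this]
    · ext t
      by_cases h1 : t ∈ Ioo 0 τ
      · by_cases h2 : γ t ∈ A
        · have h2' : t ∈ γ ⁻¹' A := h2
          by_cases h3 : f' t < 0
          · have : t ∈ Pm := ⟨h1, h3, h2⟩
            simp [h1, h2', this, abs_of_neg h3]
          · have : t ∉ Pm := fun h => h3 h.2.1
            simp [h1, h2', this, not_lt.1 h3]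
        · have h2' : t ∉ γ ⁻¹' A := h2
          have : t ∉ Pm := fun h => h2 h.2.2
          simp [h2', this]
      · have : t ∉ Pm := fun h => h1 h.1
        simp only [indicator_of_notMem h1, indicator_of_notMem this]
  rw [hint]
  have h5 := ENNReal.toReal_mono (by finiteness) hle
  rw [ENNReal.toReal_add (by finiteness) hfr.ne, ENNReal.toReal_mul, ENNReal.toReal_mul] at h5
  simp only [ENNReal.toReal_ofNat] at h5
  linarith

/-- The bound for the real part of the flux, in the complex plane. -/
lemma jc_complex (γ γ' : ℝ → ℂ) (τ : ℝ) (hτ : 0 < τ) (hd : ∀ t ∈ Ioo 0 τ, HasDerivAt γ (γ' t) t)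
    (hc' : Continuous γ') (hc : Continuous γ) (hcl : γ τ = γ 0)
    (hinj : InjOn γ (Ico 0 τ)) (D : Set ℂ) (hD : IsClosed D) (hreg : JcReg D)
    (hfr : μH[(1 : ℝ)] (frontier D) < ⊤) :
    ∫ t in (0 : ℝ)..τ, (γ ⁻¹' D).indicator (fun t => (γ' t).re) t ≤
      (μH[(1 : ℝ)] (frontier D)).toReal / 2 := by
  obtain ⟨A, hA, hup, hdown⟩ := jc_status D hfr
  have htri := jc_tri D A hD hreg hA
  rcases hA with rfl | rfl
  · exact jc_half γ γ' τ hτ hd hc' hc hcl hinj A hD.measurableSet hfr htri hup hdown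
  · have hDm : MeasurableSet D := hD.measurableSet
    have h1 := jc_half (fun t => γ (τ - t)) (fun t => -γ' (τ - t)) τ hτ
      (fun t ht => by
        have h2 := (hd (τ - t) ⟨by linarith [ht.2], by linarith [ht.1]⟩).scomp t
          ((hasDerivAt_id t).const_sub τ)
        refine h2.congr_deriv ?_
        simp)
      (by fun_prop) (by fun_prop) (by simp [hcl])
      (by
        have key : ∀ t ∈ Ico 0 τ, ∃ r ∈ Ico 0 τ, γ (τ - t) = γ r ∧
            ((t = 0 ∧ r = 0) ∨ (0 < r ∧ r = τ - t)) := by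
          intro t ht
          rcases ht.1.eq_or_lt with h | h
          · exact ⟨0, ⟨le_rfl, hτ⟩, by rw [← h, sub_zero, hcl], Or.inl ⟨h.symm, rfl⟩⟩
          · exact ⟨τ - t, ⟨by linarith [ht.2], by linarith⟩, rfl, Or.inr ⟨by linarith [ht.2], rfl⟩⟩
        intro t ht r hr h
        obtain ⟨t', ht', h1, h2⟩ := key t ht
        obtain ⟨r', hr', h3, h4⟩ := key r hr
        have h5 : t' = r' := hinj ht' hr' (by rw [← h1, ← h3]; exact h)
        rcases h2 with ⟨a1, a2⟩ | ⟨a1, a2⟩ <;> rcases h4 with ⟨b1, b2⟩ | ⟨b1, b2⟩ <;> linarith)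
      Dᶜ hDm.compl (by rwa [frontier_compl]) htri hup hdown
    rw [frontier_compl] at h1
    refine le_trans (le_of_eq ?_) h1
    have hre : Continuous fun t => (γ' t).re := Complex.continuous_re.comp hc'
    have hγD : MeasurableSet (γ ⁻¹' D) := hc.measurable hDm
    have hii : ∀ S : Set ℝ, MeasurableSet S →
        IntervalIntegrable (S.indicator fun t => (γ' t).re) volume 0 τ := by
      intro S hS
      rw [intervalIntegrable_iff_integrableOn_Ioc_of_le hτ.le]
      exact ((hre.integrableOn_Icc (a := 0) (b := τ)).mono_set Ioc_subset_Icc_self).indicator hS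
    have h2 : ∫ t in (0 : ℝ)..τ, ((fun t => γ (τ - t)) ⁻¹' Dᶜ).indicator
        (fun t => (-γ' (τ - t)).re) t =
        - ∫ t in (0 : ℝ)..τ, (γ ⁻¹' D)ᶜ.indicator (fun t => (γ' t).re) t := by
      have h3 := intervalIntegral.integral_comp_sub_left (a := 0) (b := τ)
        (fun t => (γ ⁻¹' D)ᶜ.indicator (fun t => (γ' t).re) t) τ
      simp only [sub_self, sub_zero] at h3
      rw [← h3, ← intervalIntegral.integral_neg]
      congr 1
      ext t
      by_cases h : γ (τ - t) ∈ D
      · simp [indicator, h]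
      · simp [indicator, h]
    rw [h2]
    have h4 : ∫ t in (0 : ℝ)..τ, (γ' t).re = 0 := by
      have := intervalIntegral.integral_eq_sub_of_hasDerivAt_of_le hτ.le
        (f := fun t => (γ t).re) (f' := fun t => (γ' t).re)
        (Complex.continuous_re.comp hc).continuousOn
        (fun t ht => Complex.reCLM.hasFDerivAt.comp_hasDerivAt t (hd t ht))
        (hre.intervalIntegrable _ _)
      rw [this, hcl, sub_self]
    have h5 : ∫ t in (0 : ℝ)..τ, (γ' t).re =
        (∫ t in (0 : ℝ)..τ, (γ ⁻¹' D).indicator (fun t => (γ' t).re) t) +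
        ∫ t in (0 : ℝ)..τ, (γ ⁻¹' D)ᶜ.indicator (fun t => (γ' t).re) t := by
      rw [← intervalIntegral.integral_add (hii _ hγD) (hii _ hγD.compl)]
      congr 1
      ext t
      by_cases h : γ t ∈ D <;> simp [indicator, h]
    linarith

/-- **Planar corollary.**  Let `x₁ : [0, τ₁] → ℝ²` be a smooth parametrized Jordan curve
(a smooth closed curve, injective on `[0, τ₁)`) and let `D₂ ⊆ ℝ²` be a regular domain whose
boundary has finite length `L₂`.  Then `|∫₀^{τ₁} χ_{D₂}(x₁(t)) x₁'(t) dt| ≤ L₂ / 2`. -/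
theorem jordan_curve_flux_bound (τ₁ : ℝ) (hτ : 0 < τ₁)
    (x₁ : ℝ → EuclideanSpace ℝ (Fin 2))
    (hsmooth : ContDiffOn ℝ (⊤ : ℕ∞) x₁ (Set.Icc 0 τ₁))
    (hclosed : x₁ τ₁ = x₁ 0)
    (hinj : Set.InjOn x₁ (Set.Ico 0 τ₁))
    (D₂ : RegularDomain 2) (L₂ : ℝ)
    (hlen : (μH[(1 : ℝ)] (frontier D₂.carrier)).toReal = L₂)
    (hlen_fin : μH[(1 : ℝ)] (frontier D₂.carrier) < ⊤) :
    ‖∫ t in (0 : ℝ)..τ₁,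
        Set.indicator D₂.carrier (fun _ => (1 : ℝ)) (x₁ t) •
          derivWithin x₁ (Set.Icc 0 τ₁) t‖ ≤ L₂ / 2 := by
  have hU : UniqueDiffOn ℝ (Icc (0 : ℝ) τ₁) := uniqueDiffOn_Icc hτ
  have hd0 : ContinuousOn (derivWithin x₁ (Icc 0 τ₁)) (Icc 0 τ₁) :=
    hsmooth.continuousOn_derivWithin hU (by exact_mod_cast le_top)
  set I := ∫ t in (0 : ℝ)..τ₁, Set.indicator D₂.carrier (fun _ => (1 : ℝ)) (x₁ t) •
          derivWithin x₁ (Set.Icc 0 τ₁) t with hI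
  set Φ₀ : EuclideanSpace ℝ (Fin 2) ≃ₗᵢ[ℝ] ℂ := Complex.orthonormalBasisOneI.repr.symm
  set Φ : EuclideanSpace ℝ (Fin 2) ≃ₗᵢ[ℝ] ℂ :=
    Φ₀.trans (rotation (Circle.exp (-Complex.arg (Φ₀ I)))) with hΦ
  have hΦI : (Φ I).re = ‖I‖ := by
    have h1 : Φ I = ((‖Φ₀ I‖ : ℝ) : ℂ) := by
      have h2 : Φ I = Complex.exp ((-Complex.arg (Φ₀ I) : ℝ) * Complex.I) * Φ₀ I := by
        rw [← Circle.coe_exp]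
        rfl
      rw [h2]
      have h3 := Complex.norm_mul_exp_arg_mul_I (Φ₀ I)
      calc _ = Complex.exp ((-Complex.arg (Φ₀ I) : ℝ) * Complex.I) *
            (‖Φ₀ I‖ * Complex.exp (Complex.arg (Φ₀ I) * Complex.I)) := by rw [h3]
        _ = _ := by
          rw [mul_left_comm, ← Complex.exp_add]
          simp
    rw [h1, Complex.ofReal_re, Φ₀.norm_map]
  set D : Set ℂ := Φ.symm ⁻¹' D₂.carrier with hD
  have hfr : frontier D = Φ '' frontier D₂.carrier := by
    have h1 := Φ.symm.toHomeomorph.preimage_frontier D₂.carrier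
    have h2 : frontier D = Φ.symm ⁻¹' frontier D₂.carrier := h1.symm
    rw [h2]
    exact (Φ.toEquiv.image_eq_preimage_symm _).symm
  have hμ : μH[(1 : ℝ)] (frontier D) = μH[(1 : ℝ)] (frontier D₂.carrier) := by
    rw [hfr]
    exact Φ.toIsometryEquiv.hausdorffMeasure_image 1 _
  have hDc : IsClosed D := D₂.isClosed.preimage Φ.symm.continuous
  have hreg : JcReg D := by
    intro p hp
    rw [hfr] at hp
    obtain ⟨q, hq, rfl⟩ := hp
    obtain ⟨U, hUo, hqU, u, hu, hg, hDU, -⟩ := D₂.regular q hq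
    refine ⟨Φ.symm ⁻¹' U, hUo.preimage Φ.symm.continuous, by simpa using hqU, u ∘ Φ.symm, ?_, ?_, ?_⟩
    · exact ContDiffOn.comp (hu.of_le (by exact_mod_cast le_top))
        Φ.symm.toContinuousLinearEquiv.contDiff.contDiffOn (fun x hx => hx)
    · intro x hx h0
      have h1 := Φ.symm.toContinuousLinearEquiv.comp_right_fderiv (f := u) (x := x)
      have h2 : fderiv ℝ u (Φ.symm x) = 0 := by
        have h3 : (fderiv ℝ u (Φ.symm x)).comp
          (Φ.symm.toContinuousLinearEquiv : ℂ →L[ℝ] EuclideanSpace ℝ (Fin 2)) = 0 := by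
          rw [← h0]; exact h1.symm
        ext v
        have := DFunLike.congr_fun h3 (Φ v)
        simpa using this
      apply hg _ hx
      simp [gradient, h2]
    · ext x
      have := Set.ext_iff.mp hDU (Φ.symm x)
      simpa [hD] using this
  set γ : ℝ → ℂ := fun t => Φ (IccExtend hτ.le ((Icc 0 τ₁).domRestrict x₁) t) with hγ
  set γ' : ℝ → ℂ := fun t =>
    Φ (IccExtend hτ.le ((Icc 0 τ₁).domRestrict (derivWithin x₁ (Icc 0 τ₁))) t) with hγ'
  have e1 : ∀ t ∈ Icc 0 τ₁, γ t = Φ (x₁ t) := by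
    intro t ht
    simp [hγ, IccExtend_of_mem _ _ ht]
  have e2 : ∀ t ∈ Icc 0 τ₁, γ' t = Φ (derivWithin x₁ (Icc 0 τ₁) t) := by
    intro t ht
    simp [hγ', IccExtend_of_mem _ _ ht]
  have hcγ : Continuous γ :=
    Φ.continuous.comp (hsmooth.continuousOn.domRestrict.Icc_extend')
  have hcγ' : Continuous γ' :=
    Φ.continuous.comp (hd0.domRestrict.Icc_extend')
  have hdγ : ∀ t ∈ Ioo 0 τ₁, HasDerivAt γ (γ' t) t := by
    intro t ht
    have ht' := Ioo_subset_Icc_self ht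
    have hn : Icc 0 τ₁ ∈ 𝓝 t := Icc_mem_nhds ht.1 ht.2
    have h1 : HasDerivAt x₁ (derivWithin x₁ (Icc 0 τ₁) t) t :=
      ((hsmooth.differentiableOn (by simp)) t ht').hasDerivWithinAt.hasDerivAt hn
    have h2 : HasDerivAt (fun t => Φ (x₁ t)) (Φ (derivWithin x₁ (Icc 0 τ₁) t)) t :=
      Φ.toContinuousLinearEquiv.toContinuousLinearMap.hasFDerivAt.comp_hasDerivAt t h1
    rw [e2 t ht']
    refine h2.congr_of_eventuallyEq ?_
    filter_upwards [hn] with s hs using e1 s hs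
  have h0 : (0 : ℝ) ∈ Icc 0 τ₁ := ⟨le_rfl, hτ.le⟩
  have h1 : τ₁ ∈ Icc 0 τ₁ := ⟨hτ.le, le_rfl⟩
  have hinjγ : InjOn γ (Ico 0 τ₁) := by
    intro a ha b hb hab
    rw [e1 a (Ico_subset_Icc_self ha), e1 b (Ico_subset_Icc_self hb)] at hab
    exact hinj ha hb (Φ.injective hab)
  have key := jc_complex γ γ' τ₁ hτ hdγ hcγ' hcγ (by rw [e1 _ h0, e1 _ h1, hclosed]) hinjγ D hDc
    hreg (by rw [hμ]; exact hlen_fin)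
  rw [hμ, hlen] at key
  refine le_trans (le_of_eq ?_) key
  rw [← hΦI]
  have hII : I = ∫ t in (0 : ℝ)..τ₁, (γ ⁻¹' D).indicator (fun t => Φ.symm (γ' t)) t := by
    apply intervalIntegral.integral_congr
    intro t ht
    rw [uIcc_of_le hτ.le] at ht
    have h3 : t ∈ γ ⁻¹' D ↔ x₁ t ∈ D₂.carrier := by
      simp [hD, mem_preimage, e1 t ht]
    by_cases h : x₁ t ∈ D₂.carrier
    · simp [indicator_of_mem (h3.2 h), h, e2 t ht]
    · simp [indicator_of_notMem (fun h' => h (h3.1 h')), h]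
  have hint : IntervalIntegrable ((γ ⁻¹' D).indicator (fun t => Φ.symm (γ' t))) volume 0 τ₁ := by
    have h3 : IntervalIntegrable (fun t => Φ.symm (γ' t)) volume 0 τ₁ :=
      (Φ.symm.continuous.comp hcγ').intervalIntegrable _ _
    rw [intervalIntegrable_iff] at h3 ⊢
    exact h3.indicator (hDc.preimage hcγ).measurableSet
  have h4 := ContinuousLinearMap.intervalIntegral_comp_comm
    (Complex.reCLM.comp Φ.toContinuousLinearEquiv.toContinuousLinearMap) hint
  have h5 : (Φ I).re = (Complex.reCLM.comp Φ.toContinuousLinearEquiv.toContinuousLinearMap) I := rfl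
  rw [h5, hII, ← h4]
  congr 1
  ext t
  by_cases h : t ∈ γ ⁻¹' D
  · simp [indicator_of_mem h]
  · simp [indicator_of_notMem h]

end
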